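/- arXiv:1905.03612 — 4 statements merged into one kernel-verified Lean document; each statement's English description precedes it below -/
import Mathlib

section
/- Let H=(V,E) be a simple countable k-uniform hypergraph with k ≥ 2. If for every injection φ: E → ℕ there exists an infinite (k−1)-branching tree in H that is increasing under φ, then H has property C_2. -/
/-- Property `C_ℓ` of a `k`-uniform hypergraph with edge set `E`: there is a nonempty set of
vertices `V'` such that every `v ∈ V'` lies in infinitely many edges `e` with `|V' ∩ e| ≥ ℓ`. -/
def PropC {V : Type*} (E : Set (Finset V)) (ℓ : ℕ) : Prop :=
  ∃ V' : Set V, V'.Nonempty ∧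
    ∀ v ∈ V', {e | e ∈ E ∧ v ∈ e ∧ ℓ ≤ ((e : Set V) ∩ V').ncard}.Infinite

/-- The `i`-th edge of the infinite loose path with vertex sequence `w` (0-indexed):
`{w ((k-1)i), w ((k-1)i + 1), …, w ((k-1)i + k - 1)}`. -/
def looseEdge {V : Type*} [DecidableEq V] (k : ℕ) (w : ℕ → V) (i : ℕ) : Finset V :=
  (Finset.range k).image fun j => w ((k - 1) * i + j)

/-- The edge of an infinite `(k-1)`-branching tree `x` at the node indexed by
the finite sequence `s`: `{x s} ∪ {x (a :: s) | a ∈ Fin (k-1)}`. -/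
def treeEdge {V : Type*} [DecidableEq V] (k : ℕ) (x : List (Fin (k - 1)) → V)
    (s : List (Fin (k - 1))) : Finset V :=
  insert (x s) (Finset.univ.image fun a : Fin (k - 1) => x (a :: s))

/-- A hypergraph is simple if any two distinct vertices lie together in at most one edge. -/
def SimpleHyper {V : Type*} (E : Set (Finset V)) : Prop :=
  ∀ e ∈ E, ∀ f ∈ E, ∀ u v : V, u ≠ v → u ∈ e → v ∈ e → u ∈ f → v ∈ f → e = f

universe u

/-- If no vertex set witnesses `C_2`, the vertices can be ranked injectively by ordinals so that each
vertex is non-maximal in only finitely many edges. -/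
lemma exists_rank_of_not_propC {V : Type u} [Nonempty V] {E : Set (Finset V)} (h : ¬ PropC E 2) :
    ∃ r : V → Ordinal.{u}, Function.Injective r ∧
      ∀ v, {e | e ∈ E ∧ v ∈ e ∧ ∃ u ∈ e, r v < r u}.Finite := by
  have hpeel : ∀ A : Set V, ∃ v, A.Nonempty → v ∈ A ∧
      {e | e ∈ E ∧ v ∈ e ∧ 2 ≤ ((e : Set V) ∩ A).ncard}.Finite := by
    intro A
    by_cases hA : A.Nonempty
    · by_contra! hc
      exact h ⟨A, hA, fun v hv => (hc v).2 hv⟩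
    · exact ⟨Classical.arbitrary V, fun h' => absurd h' hA⟩
  choose g hg using hpeel
  let f : Ordinal.{u} → V := WellFoundedLT.fix (motive := fun _ => V) fun α ih =>
    g {v | ∀ β (hβ : β < α), ih β hβ ≠ v}
  have hf : ∀ α, f α = g {v | ∀ β < α, f β ≠ v} := fun α => WellFoundedLT.fix_eq
    (motive := fun _ => V) _ α
  have hsurj : ∀ v, ∃ α, f α = v := by
    by_contra! hc
    obtain ⟨v, hv⟩ := hc
    refine not_injective_of_ordinal f fun α β hαβ => ?_
    have hmem : ∀ α, ∀ β < α, f β ≠ f α := fun α β hβ => by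
      have := (hg {v | ∀ β < α, f β ≠ v} ⟨v, fun β _ => hv β⟩).1
      rw [← hf] at this
      exact this β hβ
    rcases lt_trichotomy α β with hlt | rfl | hlt
    · exact absurd hαβ (hmem β α hlt)
    · rfl
    · exact absurd hαβ.symm (hmem α β hlt)
  let r : V → Ordinal.{u} := fun v => sInf {α | f α = v}
  have hr : ∀ v, f (r v) = v := fun v => csInf_mem (hsurj v)
  have hrmin : ∀ v, ∀ β < r v, f β ≠ v := fun v β hβ hv => notMem_of_lt_csInf' hβ hv
  refine ⟨r, fun u v huv => by rw [← hr u, huv, hr v], fun v => ?_⟩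
  have hv := (hg {u | ∀ β < r v, f β ≠ u} ⟨v, hrmin v⟩).2
  rw [← hf, hr] at hv
  refine hv.subset fun e he => ?_
  obtain ⟨heE, hve, u, hue, huv⟩ := he
  refine ⟨heE, hve, ?_⟩
  have : 1 < ((e : Set V) ∩ {u | ∀ β < r v, f β ≠ u}).ncard := by
    rw [Set.one_lt_ncard (e.finite_toSet.inter_of_left _)]
    exact ⟨v, ⟨hve, hrmin v⟩, u, ⟨hue, fun β hβ => hrmin u β (hβ.trans huv)⟩,
      fun h => huv.ne (by rw [h])⟩
  exact this

/-- A locally finite directed graph on a countable type has a finite-to-one level function that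
increases by at most one along each arc. -/
lemma exists_level {V : Type*} [Countable V] (g : V → Set V) (hg : ∀ v, (g v).Finite) :
    ∃ l : V → ℕ, (∀ m, {v | l v ≤ m}.Finite) ∧ ∀ v, ∀ u ∈ g v, l u ≤ l v + 1 := by
  obtain ⟨n, hn⟩ := Countable.exists_injective_nat V
  let W : ℕ → Set V := fun m =>
    Nat.rec ∅ (fun m S => S ∪ (⋃ v ∈ S, g v) ∪ {v | n v ≤ m}) m
  have hW : ∀ m, W (m + 1) = W m ∪ (⋃ v ∈ W m, g v) ∪ {v | n v ≤ m} := fun m => rfl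
  have hfin : ∀ m, (W m).Finite := by
    intro m
    induction m with
    | zero => exact Set.finite_empty
    | succ m ih =>
      rw [hW]
      exact (ih.union (ih.biUnion fun v _ => hg v)).union
        ((Set.finite_Iic m).preimage hn.injOn)
  have hmono : Monotone W := monotone_nat_of_le_succ fun m => by
    rw [hW]
    exact fun v hv => Or.inl (Or.inl hv)
  have hex : ∀ v, ∃ m, v ∈ W m := fun v => ⟨n v + 1, Or.inr (le_refl (n v))⟩
  let l : V → ℕ := fun v => sInf {m | v ∈ W m}
  have hl : ∀ v, v ∈ W (l v) := fun v => Nat.sInf_mem (hex v)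
  refine ⟨l, fun m => (hfin m).subset fun v hv => hmono hv (hl v), fun v u hu => ?_⟩
  refine Nat.sInf_le (?_ : u ∈ W (l v + 1))
  rw [hW]
  exact Or.inl (Or.inr (Set.mem_biUnion (hl v) hu))

/-- A transitive irreflexive relation on a countable type in which every element has finitely many
predecessors is respected by an injection into `ℕ`. -/
lemma exists_injective_nat_of_finite_pred {α : Type*} [Countable α] (R : α → α → Prop)
    (htrans : ∀ a b c, R a b → R b c → R a c) (hirr : ∀ a, ¬ R a a)
    (hfin : ∀ a, {b | R b a}.Finite) :
    ∃ φ : α → ℕ, Function.Injective φ ∧ ∀ a b, R a b → φ a < φ b := by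
  classical
  obtain ⟨n, hn⟩ := Countable.exists_injective_nat α
  let D : α → Finset α := fun a => insert a (hfin a).toFinset
  have hD : ∀ a b, b ∈ D a ↔ b = a ∨ R b a := fun a b => by simp [D]
  have hDinj : Function.Injective D := by
    intro a b hab
    have h1 := (hD b a).1 (hab ▸ (hD a a).2 (Or.inl rfl))
    have h2 := (hD a b).1 (hab ▸ (hD b b).2 (Or.inl rfl))
    rcases h1 with h1 | h1
    · exact h1
    rcases h2 with h2 | h2
    · exact h2.symm
    exact absurd (htrans _ _ _ h1 h2) (hirr a)
  refine ⟨fun a => ∑ i ∈ (D a).image n, 2 ^ i, ?_, fun a b hab => ?_⟩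
  · exact (Finset.geomSum_injective le_rfl).comp ((Finset.image_injective hn).comp hDinj)
  · have hsub : D a ⊆ D b := fun c hc => by
      rcases (hD a c).1 hc with rfl | hc
      · exact (hD b c).2 (Or.inr hab)
      · exact (hD b c).2 (Or.inr (htrans _ _ _ hc hab))
    refine Finset.sum_lt_sum_of_subset (i := n b) (Finset.image_subset_image hsub)
      (Finset.mem_image_of_mem n ((hD b b).2 (Or.inl rfl))) (fun hb => ?_) (by positivity)
      (fun _ _ _ => Nat.zero_le _)
    obtain ⟨c, hc, hcb⟩ := Finset.mem_image.1 hb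
    obtain rfl := hn hcb
    rcases (hD a c).1 hc with rfl | hc
    · exact hirr c hab
    · exact hirr c (htrans _ _ _ hc hab)

/-- A countable set with a finite-to-one block function `c` can be enumerated block by block, each
block being enumerated with non-increasing `h`. -/
lemma exists_blockwise_labelling {α β : Type*} [Countable α] [LinearOrder β] (E : Set α)
    (c : α → ℕ) (h : α → β) (hc : ∀ m, {e | e ∈ E ∧ c e ≤ m}.Finite) :
    ∃ φ : α → ℕ, Function.Injective φ ∧
      ∀ e ∈ E, ∀ f ∈ E, φ e < φ f → c e ≤ c f ∧ (c e = c f → h f ≤ h e) := by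
  obtain ⟨φ, hφ, hlt⟩ := exists_injective_nat_of_finite_pred
    (fun f e : α => f ∈ E ∧ e ∈ E ∧ (c f < c e ∨ c f = c e ∧ h e < h f))
    (by
      rintro a b d ⟨ha, -, hab⟩ ⟨-, hd, hbd⟩
      refine ⟨ha, hd, ?_⟩
      rcases hab with hab | ⟨hab, hab'⟩ <;> rcases hbd with hbd | ⟨hbd, hbd'⟩
      · exact Or.inl (hab.trans hbd)
      · exact Or.inl (hbd ▸ hab)
      · exact Or.inl (hab ▸ hbd)
      · exact Or.inr ⟨hab.trans hbd, hbd'.trans hab'⟩)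
    (by rintro a ⟨-, -, h | ⟨-, h⟩⟩ <;> exact lt_irrefl _ h)
    (fun a => (hc (c a)).subset (by rintro b ⟨hb, -, h | h⟩ <;> exact ⟨hb, by omega⟩))
  refine ⟨φ, hφ, fun e he f hf hef => ⟨?_, fun hcef => ?_⟩⟩
  · by_contra! hlt'
    exact hef.asymm (hlt f e ⟨hf, he, Or.inl hlt'⟩)
  · by_contra! hlt'
    exact hef.asymm (hlt f e ⟨hf, he, Or.inr ⟨hcef.symm, hlt'⟩⟩)

lemma mem_treeEdge {V : Type*} [DecidableEq V] {k : ℕ} {x : List (Fin (k - 1)) → V}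
    {s : List (Fin (k - 1))} {v : V} :
    v ∈ treeEdge k x s ↔ v = x s ∨ ∃ a, x (a :: s) = v := by
  simp [treeEdge]

lemma disjoint_treeEdge {V : Type*} [DecidableEq V] {k : ℕ} {x : List (Fin (k - 1)) → V}
    (hx : Function.Injective x) {s t : List (Fin (k - 1))} (h : s.length + 2 ≤ t.length) :
    Disjoint (treeEdge k x s) (treeEdge k x t) := by
  rw [Finset.disjoint_left]
  intro v hs ht
  rw [mem_treeEdge] at hs ht
  rcases hs with rfl | ⟨a, rfl⟩ <;> rcases ht with ht | ⟨b, ht⟩ <;>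
  · have := congrArg List.length (hx ht)
    grind

/-- If `C_2` fails, there are an injective labelling of the edges and two distinct vertices `hd e`,
`mt e` of each edge `e` (the vertex of maximal rank and a vertex of minimal level among the others)
such that no label-increasing sequence of edges, any two at distance two being disjoint, passes from
each edge to the next through one of these two vertices. -/
lemma exists_labelling {V : Type*} [Countable V] [Nonempty V] {E : Set (Finset V)}
    (hcard : ∀ e ∈ E, 2 ≤ e.card) (h : ¬ PropC E 2) :
    ∃ (φ : Finset V → ℕ) (hd mt : Finset V → V), Function.Injective φ ∧
      (∀ e ∈ E, hd e ∈ e ∧ mt e ∈ e ∧ mt e ≠ hd e) ∧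
      ∀ e : ℕ → Finset V, (∀ i, e i ∈ E) → (∀ i, φ (e i) < φ (e (i + 1))) →
        (∀ i, Disjoint (e i) (e (i + 2))) →
        ¬ ∀ i, hd (e i) ∈ e (i + 1) ∨ mt (e i) ∈ e (i + 1) := by
  classical
  obtain ⟨r, hr, hrfin⟩ := exists_rank_of_not_propC h
  obtain ⟨l, hlfin, hl⟩ := exists_level
    (fun v => ⋃ e ∈ {e | e ∈ E ∧ v ∈ e ∧ ∃ u ∈ e, r v < r u}, (e : Set V))
    (fun v => (hrfin v).biUnion fun e _ => e.finite_toSet)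
  have hex : ∀ e, ∃ a b, e ∈ E → a ∈ e ∧ b ∈ e ∧ b ≠ a ∧ (∀ v ∈ e, v ≠ a → r v < r a) ∧
      ∀ v ∈ e, v ≠ a → l b ≤ l v := by
    intro e
    by_cases he : e ∈ E
    · have h2 := hcard e he
      obtain ⟨a, ha, hamax⟩ := e.exists_max_image r (Finset.card_pos.1 (by omega))
      obtain ⟨b, hb, hbmin⟩ := (e.erase a).exists_min_image l
        (Finset.card_pos.1 (by rw [Finset.card_erase_of_mem ha]; omega))
      rw [Finset.mem_erase] at hb
      exact ⟨a, b, fun _ => ⟨ha, hb.2, hb.1,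
        fun v hv hva => lt_of_le_of_ne (hamax v hv) fun h => hva (hr h),
        fun v hv hva => hbmin v (Finset.mem_erase.2 ⟨hva, hv⟩)⟩⟩
    · exact ⟨Classical.arbitrary V, Classical.arbitrary V, fun h => absurd h he⟩
  choose hd mt hspec using hex
  have hstep : ∀ e ∈ E, ∀ u ∈ e, ∀ v ∈ e, v ≠ hd e → l u ≤ l v + 1 := by
    intro e he u hu v hv hvh
    obtain ⟨hhd, -, -, hlt, -⟩ := hspec e he
    exact hl v u (Set.mem_biUnion (x := e) ⟨he, hv, hd e, hhd, hlt v hv hvh⟩ hu)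
  -- Within two consecutive levels: odd new edges, then even new edges, then old edges.
  let c : Finset V → ℕ := fun e => 4 * (l (mt e) / 2) +
    if l (hd e) ≤ l (mt e) then 3 else if l (mt e) % 2 = 1 then 1 else 2
  have hcold : ∀ e, l (hd e) ≤ l (mt e) → c e = 4 * (l (mt e) / 2) + 3 := fun e h => by
    simp [c, h]
  have hcnew : ∀ e, l (mt e) < l (hd e) → c e + 2 * (l (mt e) % 2) + (1 - l (mt e) % 2) =
      4 * (l (mt e) / 2) + 3 := fun e h => by
    simp only [c, not_le.2 h, if_false]
    split_ifs <;> omega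
  have hLc : ∀ e, l (mt e) ≤ c e := fun e => by
    rcases le_or_gt (l (hd e)) (l (mt e)) with h | h
    · have := hcold e h; omega
    · have := hcnew e h; omega
  have hLfin : ∀ m, {e | e ∈ E ∧ l (mt e) ≤ m}.Finite := fun m =>
    ((hlfin m).biUnion fun v _ => hrfin v).subset fun e ⟨he, hm⟩ => by
      obtain ⟨hhd, hmt, hne, hlt, -⟩ := hspec e he
      exact Set.mem_biUnion (x := mt e) hm ⟨he, hmt, hd e, hhd, hlt _ hmt hne⟩
  obtain ⟨φ, hφ, hmono⟩ := exists_blockwise_labelling E c (fun e => r (hd e))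
    fun m => (hLfin m).subset fun e ⟨he, hm⟩ => ⟨he, (hLc e).trans hm⟩
  refine ⟨φ, hd, mt, hφ, fun e he => ⟨(hspec e he).1, (hspec e he).2.1, (hspec e he).2.2.1⟩,
    fun e heE heφ hdisj hmeet => ?_⟩
  have hφmono : StrictMono fun i => φ (e i) := strictMono_nat_of_lt_succ heφ
  have hold : ∀ i, l (hd (e i)) ≤ l (mt (e i)) → l (hd (e (i + 1))) ≤ l (mt (e (i + 1))) ∧
      r (hd (e (i + 1))) ≤ r (hd (e i)) := by
    intro i hi
    obtain ⟨hcle, hceq⟩ := hmono _ (heE i) _ (heE (i + 1)) (heφ i)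
    obtain ⟨hhd, hmt, hne, hlt, hmin⟩ := hspec _ (heE i)
    obtain ⟨hhd', hmt', hne', hlt', hmin'⟩ := hspec _ (heE (i + 1))
    have hc1 := hcold _ hi
    have hc2 := hcold (e (i + 1))
    have hc3 := hcnew (e (i + 1))
    have hs := hstep _ (heE (i + 1)) _ hhd' _ hmt' hne'
    obtain ⟨v, hv, hve, hvl, hvr⟩ : ∃ v ∈ e (i + 1), v ∈ e i ∧ l v ≤ l (mt (e i)) ∧
        r v ≤ r (hd (e i)) := by
      rcases hmeet i with h | h
      · exact ⟨_, h, hhd, hi, le_rfl⟩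
      · exact ⟨_, h, hmt, le_rfl, (hlt _ hmt hne).le⟩
    by_cases hvh : v = hd (e (i + 1))
    · rw [hvh] at hvl hvr
      exact ⟨by omega, hvr⟩
    · have := hmin' v hv hvh
      exact ⟨by omega, hceq (by omega)⟩
  by_cases hall : ∃ i, l (hd (e i)) ≤ l (mt (e i))
  · obtain ⟨i₀, hi₀⟩ := hall
    have hold' : ∀ j, l (hd (e (i₀ + j))) ≤ l (mt (e (i₀ + j))) := fun j => by
      induction j with
      | zero => exact hi₀
      | succ j ih => exact (hold _ ih).1
    have hanti : Antitone fun j => r (hd (e (i₀ + j))) :=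
      antitone_nat_of_succ_le fun j => (hold _ (hold' j)).2
    obtain ⟨m, hm⟩ := WellFoundedLT.antitone_chain_condition hanti
    have heq : hd (e (i₀ + m)) = hd (e (i₀ + m + 2)) := hr (hm (m + 2) (by omega))
    exact Finset.disjoint_left.1 (hdisj (i₀ + m)) (hspec _ (heE _)).1
      (heq ▸ (hspec _ (heE _)).1)
  · push Not at hall
    have hbdd : ∀ i, l (mt (e i)) ≤ 2 * l (mt (e 0)) := by
      intro i
      induction i with
      | zero => omega
      | succ i ih =>
        obtain ⟨hcle, -⟩ := hmono _ (heE i) _ (heE (i + 1)) (heφ i)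
        obtain ⟨hhd, hmt, hne, hlt, hmin⟩ := hspec _ (heE i)
        obtain ⟨hhd', hmt', hne', hlt', hmin'⟩ := hspec _ (heE (i + 1))
        have hc1 := hcnew _ (hall i)
        have hc2 := hcnew _ (hall (i + 1))
        have hs := hstep _ (heE i) _ hhd _ hmt hne
        obtain ⟨v, hv, hvl⟩ : ∃ v ∈ e (i + 1), l v ≤ l (mt (e i)) + 1 := by
          rcases hmeet i with h | h
          · exact ⟨_, h, hs⟩
          · exact ⟨_, h, by omega⟩
        have : l (mt (e (i + 1))) ≤ l v := by
          by_cases hvh : v = hd (e (i + 1))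
          · rw [hvh]; exact (hall (i + 1)).le
          · exact hmin' v hv hvh
        omega
    have hinj : Function.Injective e := fun i j hij => hφmono.injective (congrArg φ hij)
    exact Set.infinite_of_injective_forall_mem
      (s := {f | f ∈ E ∧ l (mt f) ≤ 2 * l (mt (e 0))}) hinj (fun i => ⟨heE i, hbdd i⟩)
      (hLfin (2 * l (mt (e 0))))

theorem stmt3 {V : Type*} [Countable V] [Infinite V] [DecidableEq V]
    (k : ℕ) (hk : 2 ≤ k) (E : Set (Finset V)) (hunif : ∀ e ∈ E, e.card = k)
    (hsimple : SimpleHyper E)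
    (htree : ∀ φ : Finset V → ℕ, Set.InjOn φ E →
      ∃ x : List (Fin (k - 1)) → V, Function.Injective x ∧
        (∀ s, treeEdge k x s ∈ E) ∧
        (∀ s t : List (Fin (k - 1)), s.length < t.length →
          φ (treeEdge k x s) < φ (treeEdge k x t))) :
    PropC E 2 := by
  by_contra hC
  obtain ⟨φ, hd, mt, hφ, hspec, hno⟩ :=
    exists_labelling (fun e he => hk.trans (hunif e he).ge) hC
  obtain ⟨x, hx, hxE, hinc⟩ := htree φ hφ.injOn
  have hnext : ∀ s, ∃ a, x (a :: s) = hd (treeEdge k x s) ∨ x (a :: s) = mt (treeEdge k x s) := by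
    intro s
    obtain ⟨hhd, hmt, hne⟩ := hspec _ (hxE s)
    rcases mem_treeEdge.1 hhd with h | ⟨a, ha⟩
    · rcases mem_treeEdge.1 hmt with h' | ⟨a, ha⟩
      · exact absurd (h'.trans h.symm) hne
      · exact ⟨a, Or.inr ha⟩
    · exact ⟨a, Or.inl ha⟩
  choose a ha using hnext
  let p : ℕ → List (Fin (k - 1)) := fun i => Nat.rec [] (fun _ s => a s :: s) i
  have hp : ∀ i, p (i + 1) = a (p i) :: p i := fun i => rfl
  refine hno (fun i => treeEdge k x (p i)) (fun i => hxE _) (fun i => hinc _ _ (by simp [hp]))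
    (fun i => disjoint_treeEdge hx (by simp [hp])) fun i => ?_
  exact (ha (p i)).imp (fun h => mem_treeEdge.2 (Or.inl (by rw [hp, h])))
    fun h => mem_treeEdge.2 (Or.inl (by rw [hp, h]))
end

section
/- For a countable graph G=(V,E) the following are equivalent: (1) for every partition of V into two infinite sets V_1, V_2 there exist W_1 ⊆ V_1 and W_2 ⊆ V_2 such that for i = 1,2 every v ∈ W_i has infinitely many neighbors in W_i, and there exists an edge of G joining some w_1 ∈ W_1 to some w_2 ∈ W_2; (2) for every bijection φ: V → ℤ there exists an infinite increasing two-sided path in G. -/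
/-- There is an infinite increasing two-sided path in `G` under the vertex labeling `φ`:
pairwise distinct vertices indexed by `ℤ`, consecutive ones adjacent with increasing labels. -/
def InfIncrTwoSidedPath {V : Type*} (G : SimpleGraph V) (φ : V → ℤ) : Prop :=
  ∃ w : ℤ → V, Function.Injective w ∧ ∀ i : ℤ, G.Adj (w i) (w (i + 1)) ∧ φ (w i) < φ (w (i + 1))

open Relation

/-- A well-founded relation on each fibre of `f`, together with the order on the values of `f`,
gives a well-founded relation. -/
theorem wellFounded_of_fibres {V α : Type*} [LT α] [WellFoundedLT α] (f : V → α)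
    {r : V → V → Prop} {s : α → V → V → Prop} (hs : ∀ n, WellFounded (s n))
    (h : ∀ a b, r a b → f a < f b ∨ (f a = f b ∧ s (f b) a b)) : WellFounded r := by
  have key : ∀ n : α, ∀ b, f b = n → Acc r b := by
    intro n
    induction n using WellFoundedLT.induction with
    | ind n ih =>
      intro b
      induction b using (hs n).induction with
      | _ b ihb =>
        intro hb
        refine ⟨b, fun a hab => ?_⟩
        rcases h a b hab with h1 | ⟨h1, h2⟩
        · exact ih _ (hb ▸ h1) a rfl
        · exact ihb a (hb ▸ h2) (h1.trans hb)
  exact ⟨fun b => key _ b rfl⟩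

/-- A relation without infinite descending sequences is well-founded. -/
theorem wellFounded_of_no_descending_seq {V : Type*} {r : V → V → Prop}
    (h : ∀ p : ℕ → V, ¬ ∀ i, r (p (i + 1)) (p i)) : WellFounded r :=
  wellFounded_iff_isEmpty_descending_chain.2 ⟨fun p => h p.1 p.2⟩

theorem WellFounded.no_descending_seq {V : Type*} {r : V → V → Prop} (hr : WellFounded r)
    (p : ℕ → V) : ¬ ∀ i, r (p (i + 1)) (p i) :=
  fun h => (wellFounded_iff_isEmpty_descending_chain.1 hr).false ⟨p, h⟩

/-- A finitely branching relation without infinite forward chains has finite forward closures. -/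
theorem finite_reflTransGen {V : Type*} {O : V → V → Prop} (hfin : ∀ v, {u | O v u}.Finite)
    (hwf : WellFounded (Function.swap O)) (v : V) : {u | ReflTransGen O v u}.Finite := by
  induction v using hwf.induction with
  | _ v ih =>
    refine ((Set.finite_singleton v).union ((hfin v).biUnion fun u hu => ih u hu)).subset ?_
    intro z hz
    rcases ReflTransGen.cases_head hz with h | ⟨u, hu, huz⟩
    · exact Or.inl h.symm
    · exact Or.inr (Set.mem_biUnion (show u ∈ {u | O v u} from hu) huz)

/-- A well-founded relation has no infinite forward chain inside a finite set. -/
theorem WellFounded.no_ascending_seq_of_finite {V : Type*} {O : V → V → Prop}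
    (hO : WellFounded O) {A : Set V} (hA : A.Finite) (p : ℕ → V) (hp : ∀ i, p i ∈ A) :
    ¬ ∀ i, O (p i) (p (i + 1)) := by
  intro h
  obtain ⟨i, j, hij, heq⟩ := hA.exists_lt_map_eq_of_forall_mem hp
  have h1 : TransGen O (p i) (p j) :=
    Nat.rel_of_forall_rel_succ_of_lt (TransGen O) (fun n => TransGen.single (h n)) hij
  rw [heq] at h1
  exact hO.transGen.irrefl.irrefl _ h1

/-- A finitely branching relation without infinite forward chains on a countably infinite type
can be numbered in order type `ω` so that every point comes after its successors. -/
theorem exists_equiv_nat_of_wellFounded_swap {V : Type*} [Countable V] [Infinite V]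
    {O : V → V → Prop} (hfin : ∀ v, {u | O v u}.Finite)
    (hwf : WellFounded (Function.swap O)) : ∃ f : V ≃ ℕ, ∀ v u, O v u → f u < f v := by
  classical
  obtain ⟨e, he⟩ := exists_injective_nat V
  let g : V → ℕ := fun v => ∑ u ∈ (finite_reflTransGen hfin hwf v).toFinset, (e u + 1)
  have hg : ∀ v u, O v u → g u < g v := by
    intro v u huv
    refine Finset.sum_lt_sum_of_subset (i := v) ?_ ?_ ?_ (Nat.succ_pos _) ?_
    · intro z hz
      simp only [Set.Finite.mem_toFinset, Set.mem_ofPred_eq] at hz ⊢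
      exact hz.head huv
    · simpa using ReflTransGen.refl
    · simp only [Set.Finite.mem_toFinset, Set.mem_ofPred_eq]
      intro h
      have h1 : TransGen O v v := TransGen.head' huv h
      exact hwf.transGen.irrefl.irrefl v (transGen_swap.2 h1)
    · intros; exact Nat.zero_le _
  have heg : ∀ v, e v < g v := fun v =>
    Finset.single_le_sum (f := fun u => e u + 1) (fun _ _ => Nat.zero_le _)
      (by simpa using ReflTransGen.refl)
  let k : V → ℕ := fun v => g v ^ 2 + e v
  have hk : ∀ v u, g u < g v → k u < k v := by
    intro v u h
    have := heg u
    simp only [k]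
    nlinarith
  have hkinj : Function.Injective k := by
    intro v u h
    rcases lt_trichotomy (g v) (g u) with h1 | h1 | h1
    · exact absurd h (hk _ _ h1).ne
    · simp only [k, h1] at h
      exact he (by omega)
    · exact absurd h (hk _ _ h1).ne'
  have : Infinite (Set.range k) := (Set.infinite_range_of_injective hkinj).to_subtype
  let o := Nat.Subtype.orderIsoOfNat (Set.range k)
  refine ⟨(Equiv.ofInjective k hkinj).trans o.symm.toEquiv, fun v u h => ?_⟩
  exact o.symm.strictMono (show (⟨k u, _⟩ : Set.range k) < ⟨k v, _⟩ from hk _ _ (hg _ _ h))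

/-- `O` orients every edge of `G` that meets `I`, with sources in `I`, finite out-degrees, and no
infinite directed path in either direction. -/
structure SimpleGraph.Peeling {V : Type*} (G : SimpleGraph V) (I : Set V) (O : V → V → Prop) :
    Prop where
  mem : ∀ {v u}, O v u → v ∈ I
  adj : ∀ {v u}, O v u → G.Adj v u
  total : ∀ {v u}, v ∈ I → G.Adj v u → O v u ∨ O u v
  finite : ∀ v, {u | O v u}.Finite
  wf : WellFounded O
  wf_swap : WellFounded (Function.swap O)

/-- A vertex with finitely many neighbours outside `I` can be added to `I`. -/
theorem SimpleGraph.Peeling.insert {V : Type*} {G : SimpleGraph V} {I : Set V}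
    {O : V → V → Prop} (hO : G.Peeling I O) {v : V} (hv : v ∉ I)
    (hfin : {u | u ∉ I ∧ G.Adj v u}.Finite) :
    G.Peeling (insert v I) (fun x y => O x y ∨ (x = v ∧ y ∉ I ∧ G.Adj v y)) where
  mem := by
    rintro x y (h | ⟨rfl, -, -⟩)
    · exact Or.inr (hO.mem h)
    · exact Or.inl rfl
  adj := by
    rintro x y (h | ⟨rfl, -, h⟩)
    · exact hO.adj h
    · exact h
  total := by
    rintro x y (rfl | hx) hxy
    · by_cases hy : y ∈ I
      · rcases hO.total hy hxy.symm with h | h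
        · exact Or.inr (Or.inl h)
        · exact Or.inl (Or.inl h)
      · exact Or.inl (Or.inr ⟨rfl, hy, hxy⟩)
    · rcases hO.total hx hxy with h | h
      · exact Or.inl (Or.inl h)
      · exact Or.inr (Or.inl h)
  finite x := ((hO.finite x).union hfin).subset (by
    rintro y (h | ⟨-, h⟩)
    · exact Or.inl h
    · exact Or.inr h)
  wf := by
    classical
    refine wellFounded_of_fibres (fun x => if x ∈ I then 0 else if x = v then 1 else 2)
      (s := fun _ => O) (fun _ => hO.wf) ?_
    rintro a b (h | ⟨rfl, h1, h2⟩)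
    · have := hO.mem h
      grind
    · have := h2.ne
      grind
  wf_swap := by
    classical
    refine wellFounded_of_fibres (fun x => if x ∈ I then 2 else if x = v then 1 else 0)
      (s := fun _ => Function.swap O) (fun _ => hO.wf_swap) ?_
    rintro a b (h | ⟨rfl, h1, h2⟩)
    · have := hO.mem h
      grind
    · have := h2.ne
      grind

/-- Levels along which an orientation of the edges meeting `{v | ℓ v ≠ ⊤}` ascends, without
infinite forward chains inside a single level, yield a peeling of `{v | ℓ v ≠ ⊤}`. -/
theorem SimpleGraph.exists_peeling_of_levels {V : Type*} [Countable V] {G : SimpleGraph V}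
    {O : V → V → Prop} (ℓ : V → ℕ∞)
    (mem : ∀ {v u}, O v u → ℓ v ≠ ⊤)
    (total : ∀ {v u}, ℓ v ≠ ⊤ → G.Adj v u → O v u ∨ O u v)
    (adj : ∀ {v u}, O v u → G.Adj v u)
    (finite : ∀ v, {u | O v u}.Finite)
    (wf : WellFounded O)
    (mono : ∀ {v u}, O v u → ℓ v ≤ ℓ u)
    (wf_level : ∀ n : ℕ, WellFounded (fun u v => ℓ v = n ∧ ℓ u = n ∧ O v u)) :
    ∃ O', G.Peeling {v | ℓ v ≠ ⊤} O' := by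
  classical
  rcases isEmpty_or_nonempty V with hV | hV
  · exact ⟨O, mem, adj, total, finite, wf, ⟨fun a => isEmptyElim a⟩⟩
  -- chains of bounded level are finite
  have wf_le (m : ℕ) : WellFounded (Function.swap fun v u => ℓ u ≤ m ∧ O v u) := by
    refine wellFounded_of_fibres (fun v => m - (ℓ v).toNat)
      (s := fun k u v => ℓ v = (m - k : ℕ) ∧ ℓ u = (m - k : ℕ) ∧ O v u)
      (fun k => wf_level _) ?_
    rintro u v ⟨hu, h⟩
    have h1 := mono h
    obtain ⟨a, ha⟩ := ENat.ne_top_iff_exists.1 (mem h)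
    obtain ⟨b, hb⟩ := ENat.ne_top_iff_exists.1 (ne_top_of_le_ne_top (ENat.natCast_ne_top m) hu)
    simp only [← ha, ← hb, Nat.cast_le, ENat.toNat_natCast, Nat.cast_inj] at h1 hu ⊢
    by_cases hab : a = b
    · exact Or.inr ⟨by omega, by omega, by omega, h⟩
    · exact Or.inl (by omega)
  -- a finite set meeting all infinite chains from `y`, away from a given finite set
  have barrier (S : Finset V) (y : V) : ∃ A : Finset V, (∀ z ∈ A, ℓ z ≠ ⊤) ∧
      (∀ x ∈ S, ℓ x ≠ ⊤ → ∀ z ∈ A, ¬ G.Adj x z) ∧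
      (∀ p : ℕ → V, p 0 = y → (∀ i, O (p i) (p (i + 1))) → ∃ i, p i ∈ A) := by
    let T : Finset V := insert y (S ∪ S.biUnion fun x => (finite x).toFinset)
    let m : ℕ := T.sup fun x => (ℓ x).toNat
    have hm : ∀ x ∈ T, ℓ x ≠ ⊤ → ℓ x ≤ m := by
      intro x hx hxt
      rw [← ENat.natCast_toNat hxt]
      exact_mod_cast Finset.le_sup (f := fun x => (ℓ x).toNat) hx
    have hcl : {u | ReflTransGen (fun v u => ℓ u ≤ m ∧ O v u) y u}.Finite :=
      finite_reflTransGen (fun v => (finite v).subset fun u hu => hu.2) (wf_le m) y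
    have hA : {z | (m < ℓ z ∧ ℓ z ≠ ⊤) ∧
        ∃ u, ReflTransGen (fun v u => ℓ u ≤ m ∧ O v u) y u ∧ O u z}.Finite := by
      refine (hcl.biUnion fun u _ => finite u).subset ?_
      rintro z ⟨-, u, hu, hz⟩
      exact Set.mem_biUnion (show u ∈ {u | _} from hu) hz
    refine ⟨hA.toFinset, fun z hz => ((hA.mem_toFinset).1 hz).1.2, ?_, ?_⟩
    · intro x hx hxt z hz hxz
      obtain ⟨⟨h1, h2⟩, -⟩ := (hA.mem_toFinset).1 hz
      rcases total hxt hxz with h | h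
      · refine absurd (hm z ?_ h2) h1.not_ge
        refine Finset.mem_insert_of_mem (Finset.mem_union_right _ ?_)
        exact Finset.mem_biUnion.2 ⟨x, hx, by simpa using h⟩
      · refine absurd (hm x ?_ hxt) (h1.trans_le (mono h)).not_ge
        exact Finset.mem_insert_of_mem (Finset.mem_union_left _ hx)
    · intro p hp0 hp
      have hex : ∃ i, m < ℓ (p i) := by
        by_contra! hcon
        exact (wf_le m).no_descending_seq p fun i => ⟨hcon (i + 1), hp i⟩
      have hreach : ∀ i, (∀ j ≤ i, ℓ (p j) ≤ m) →
          ReflTransGen (fun v u => ℓ u ≤ m ∧ O v u) y (p i) := by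
        intro i
        induction i with
        | zero => intro _; rw [hp0]
        | succ i ih =>
          intro h
          exact (ih fun j hj => h j (by omega)).tail ⟨h _ le_rfl, hp i⟩
      have hy : ℓ (p 0) ≤ m := hm _ (by rw [hp0]; exact Finset.mem_insert_self _ _) (mem (hp 0))
      obtain ⟨i, hi⟩ : ∃ i, Nat.find hex = i + 1 := by
        refine Nat.exists_eq_succ_of_ne_zero fun h0 => ?_
        have := Nat.find_spec hex
        rw [h0] at this
        exact this.not_ge hy
      refine ⟨i + 1, (hA.mem_toFinset).2 ⟨⟨hi ▸ Nat.find_spec hex, mem (hp _)⟩, p i, ?_, hp i⟩⟩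
      exact hreach i fun j hj => not_lt.1 (Nat.find_min hex (by omega))
  choose B hBtop hBadj hBhit using barrier
  obtain ⟨y, hy⟩ := exists_surjective_nat V
  let S : ℕ → Finset V := fun n => Nat.rec ∅ (fun n s => insert (y n) (s ∪ B s (y n))) n
  have hS (n : ℕ) : S (n + 1) = insert (y n) (S n ∪ B (S n) (y n)) := rfl
  have hSmono : Monotone S := monotone_nat_of_le_succ fun n => by
    rw [hS]; exact Finset.subset_union_left.trans (Finset.subset_insert _ _)
  let A : ℕ → Finset V := fun n => B (S n) (y n)
  have hAtop : ∀ n, ∀ z ∈ A n, ℓ z ≠ ⊤ := fun n => hBtop _ _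
  have hAS : ∀ {k n}, k < n → A k ⊆ S n := fun {k n} hkn =>
    (Finset.subset_union_right.trans (Finset.subset_insert _ _)).trans
      ((hS k).symm.subset.trans (hSmono hkn))
  have hyS : ∀ {k n}, k < n → y k ∈ S n := fun {k n} hkn =>
    hSmono hkn (hS k ▸ Finset.mem_insert_self _ _)
  have hAA : ∀ {k n x z}, x ∈ A k → z ∈ A n → G.Adj x z → k = n := by
    intro k n x z hx hz hxz
    rcases lt_trichotomy k n with h | h | h
    · exact absurd hxz (hBadj _ _ x (hAS h hx) (hAtop _ _ hx) z hz)
    · exact h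
    · exact absurd hxz.symm (hBadj _ _ z (hAS h hz) (hAtop _ _ hz) x hx)
  have hAfin : ∀ x, ℓ x ≠ ⊤ → {z | (∃ n, z ∈ A n) ∧ G.Adj x z}.Finite := by
    intro x hx
    obtain ⟨k, rfl⟩ := hy x
    refine ((Finset.range (k + 1)).biUnion A).finite_toSet.subset ?_
    rintro z ⟨⟨n, hn⟩, hz⟩
    refine Finset.mem_coe.2 (Finset.mem_biUnion.2 ⟨n, Finset.mem_range.2 ?_, hn⟩)
    by_contra hkn
    exact hBadj _ _ _ (hyS (by omega)) hx z hn hz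
  let g : V → ℕ := fun v => if ℓ v = ⊤ then 0 else if ∃ n, v ∈ A n then 1 else 2
  have hg0 : ∀ v, g v = 0 ↔ ℓ v = ⊤ := by
    intro v; dsimp only [g]; split_ifs with h1 <;> simp [h1]
  have hg1 : ∀ v, g v = 1 → ∃ n, v ∈ A n := by
    intro v; dsimp only [g]; split_ifs with h1 h2
    · simp
    · exact fun _ => h2
    · simp
  have hg2 : ∀ v, g v = 2 → ∀ n, v ∉ A n := by
    intro v; dsimp only [g]; split_ifs with h1 h2
    · simp
    · simp
    · exact fun _ n hn => h2 ⟨n, hn⟩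
  have hgle : ∀ v, g v ≤ 2 := by
    intro v; dsimp only [g]; split_ifs <;> simp
  refine ⟨fun v u => ℓ v ≠ ⊤ ∧ G.Adj v u ∧ (g u < g v ∨ g u = g v ∧ O v u), ?_⟩
  refine ⟨fun h => h.1, fun h => h.2.1, ?_, ?_, ?_, ?_⟩
  · intro v u hv hvu
    rcases lt_trichotomy (g u) (g v) with h | h | h
    · exact Or.inl ⟨hv, hvu, Or.inl h⟩
    · have hu : ℓ u ≠ ⊤ := fun hu => hv ((hg0 v).1 (h ▸ (hg0 u).2 hu))
      rcases total hv hvu with h1 | h1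
      · exact Or.inl ⟨hv, hvu, Or.inr ⟨h, h1⟩⟩
      · exact Or.inr ⟨hu, hvu.symm, Or.inr ⟨h.symm, h1⟩⟩
    · have hu : ℓ u ≠ ⊤ := fun hu => by
        have := (hg0 u).2 hu
        omega
      exact Or.inr ⟨hu, hvu.symm, Or.inl h⟩
  · intro v
    by_cases hv : ℓ v = ⊤
    · simp [hv]
    refine ((finite v).union (hAfin v hv)).subset ?_
    rintro u ⟨-, hvu, h | ⟨-, h⟩⟩
    · have h2 := hgle v
      rcases Nat.eq_zero_or_pos (g u) with h0 | h0
      · rcases total hv hvu with h1 | h1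
        · exact Or.inl h1
        · exact absurd ((hg0 u).1 h0) (mem h1)
      · exact Or.inr ⟨hg1 u (by omega), hvu⟩
    · exact Or.inl h
  · refine wellFounded_of_fibres (fun v => 2 - g v) (s := fun _ => O) (fun _ => wf) ?_
    rintro a b ⟨-, -, h | ⟨h, h1⟩⟩
    · have := hgle a
      exact Or.inl (by omega)
    · exact Or.inr ⟨by simp only [h], h1⟩
  · refine wellFounded_of_fibres g (s := fun n u v => g v = n ∧ g u = n ∧ O v u) ?_ ?_
    · intro n
      refine wellFounded_of_no_descending_seq fun p hp => ?_
      have hn : n = 0 ∨ n = 1 ∨ n = 2 := by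
        have := hgle (p 0)
        have := (hp 0).1
        omega
      rcases hn with rfl | rfl | rfl
      · exact mem (hp 0).2.2 ((hg0 _).1 (hp 0).1)
      · obtain ⟨k, hk⟩ := hg1 _ (hp 0).1
        refine wf.no_ascending_seq_of_finite (A k).finite_toSet p (fun i => ?_)
          fun i => (hp i).2.2
        induction i with
        | zero => exact hk
        | succ i ih =>
          obtain ⟨j, hj⟩ := hg1 _ (hp i).2.1
          rw [hAA ih hj (adj (hp i).2.2)]
          exact hj
      · obtain ⟨k, hk⟩ := hy (p 0)
        obtain ⟨i, hi⟩ := hBhit (S k) (y k) p hk.symm fun i => (hp i).2.2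
        exact hg2 _ (hp i).1 k hi
    · rintro a b ⟨-, -, h | ⟨h, h1⟩⟩
      · exact Or.inl h
      · exact Or.inr ⟨h, rfl, h, h1⟩

/-- Sets admitting a peeling are closed under increasing unions. -/
theorem SimpleGraph.exists_peeling_iUnion {V : Type*} [Countable V] {G : SimpleGraph V}
    {I : ℕ → Set V} (hI : ∀ n, ∃ O, G.Peeling (I n) O) :
    ∃ O, G.Peeling (⋃ n, I n) O := by
  choose O hO using hI
  let ℓ : V → ℕ∞ := fun v => ⨅ (n : ℕ) (_ : v ∈ I n), (n : ℕ∞)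
  have hle : ∀ {v n}, v ∈ I n → ℓ v ≤ n := fun {v n} h => iInf₂_le n h
  have htop : ∀ {v}, ℓ v ≠ ⊤ ↔ ∃ n, v ∈ I n := by
    intro v
    simp [ℓ]
  have hmem : ∀ {v} {n : ℕ}, ℓ v = n → v ∈ I n := by
    classical
    intro v n h
    have hex : ∃ n, v ∈ I n := htop.1 (h ▸ ENat.natCast_ne_top n)
    have h1 : ℓ v = Nat.find hex := le_antisymm (hle (Nat.find_spec hex))
      (le_iInf₂ fun k hk => by exact_mod_cast Nat.find_min' hex hk)
    have h2 : n = Nat.find hex := by exact_mod_cast h.symm.trans h1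
    rw [h2]
    exact Nat.find_spec hex
  have hU : (⋃ n, I n) = {v | ℓ v ≠ ⊤} := by
    ext v
    simp only [Set.mem_iUnion, Set.mem_ofPred_eq, htop]
  rw [hU]
  have hlt : ∀ {v u} {n : ℕ}, ℓ v = n → n ≤ ℓ u → G.Adj v u → O n v u ∨ (ℓ u = n ∧ O n u v) := by
    intro v u n hv hu hvu
    rcases (hO n).total (hmem hv) hvu with h | h
    · exact Or.inl h
    · exact Or.inr ⟨le_antisymm (hle ((hO n).mem h)) hu, h⟩
  refine exists_peeling_of_levels (O := fun v u => ∃ n : ℕ, ℓ v = n ∧ n ≤ ℓ u ∧ O n v u) ℓ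
    ?_ ?_ ?_ ?_ ?_ ?_ ?_
  · rintro v u ⟨n, hn, -⟩
    exact hn ▸ ENat.natCast_ne_top n
  · intro v u hv hvu
    obtain ⟨n, hn⟩ := ENat.ne_top_iff_exists.1 hv
    rcases le_or_gt (n : ℕ∞) (ℓ u) with h | h
    · rcases hlt hn.symm h hvu with h1 | ⟨h1, h2⟩
      · exact Or.inl ⟨n, hn.symm, h, h1⟩
      · exact Or.inr ⟨n, h1, hn.le, h2⟩
    · obtain ⟨k, hk⟩ := ENat.ne_top_iff_exists.1 (ne_top_of_lt h)
      rw [← hk] at h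
      rcases hlt hk.symm (hn ▸ h.le) hvu.symm with h1 | ⟨h1, -⟩
      · exact Or.inr ⟨k, hk.symm, hn ▸ h.le, h1⟩
      · rw [← hn] at h1
        exact absurd h1 h.ne'
  · rintro v u ⟨n, -, -, h⟩
    exact (hO n).adj h
  · intro v
    by_cases hv : ℓ v = ⊤
    · refine Set.Finite.subset Set.finite_empty ?_
      rintro u ⟨n, hn, -⟩
      exact ENat.natCast_ne_top n (hn.symm.trans hv)
    · obtain ⟨n, hn⟩ := ENat.ne_top_iff_exists.1 hv
      refine ((hO n).finite v).subset ?_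
      rintro u ⟨k, hk, -, h⟩
      have : n = k := by exact_mod_cast hn.trans hk
      exact this ▸ h
  · refine wellFounded_of_fibres ℓ (s := fun k a b => ∃ n : ℕ, k = n ∧ O n a b) ?_ ?_
    · intro k
      by_cases hk : k = ⊤
      · refine ⟨fun b => ⟨b, ?_⟩⟩
        rintro a ⟨n, hn, -⟩
        exact absurd (hn.symm.trans hk) (ENat.natCast_ne_top n)
      · obtain ⟨n, rfl⟩ := ENat.ne_top_iff_exists.1 hk
        refine Subrelation.wf ?_ (hO n).wf
        rintro a b ⟨m, hm, h⟩
        have : n = m := by exact_mod_cast hm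
        exact this ▸ h
    · rintro a b ⟨n, hn, hb, h⟩
      rcases hb.lt_or_eq with h1 | h1
      · exact Or.inl (hn ▸ h1)
      · exact Or.inr ⟨hn.trans h1, n, h1.symm, h⟩
  · rintro v u ⟨n, hn, hu, -⟩
    exact hn ▸ hu
  · intro n
    refine Subrelation.wf ?_ (hO n).wf_swap
    rintro u v ⟨hv, -, m, hm, -, h⟩
    have : n = m := by exact_mod_cast hv.symm.trans hm
    exact this ▸ h

/-- Some set with a peeling has a complement in which all degrees are infinite. -/
theorem SimpleGraph.exists_peeling_compl {V : Type*} [Countable V] (G : SimpleGraph V) :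
    ∃ I O, G.Peeling I O ∧ ∀ v ∈ Iᶜ, {u | u ∈ Iᶜ ∧ G.Adj v u}.Infinite := by
  obtain ⟨I, hI⟩ := zorn_subset {I : Set V | ∃ O, G.Peeling I O} (by
    intro c hc hchain
    rcases (⋃₀ c).eq_empty_or_nonempty with hempty | hne
    · refine ⟨∅, ⟨fun _ _ => False, ?_⟩, fun s hs => hempty ▸ Set.subset_sUnion_of_mem hs⟩
      exact ⟨False.elim, False.elim, fun h => absurd h (Set.notMem_empty _),
        fun _ => Set.finite_empty, ⟨fun _ => ⟨_, fun _ h => h.elim⟩⟩,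
        ⟨fun _ => ⟨_, fun _ h => h.elim⟩⟩⟩
    · have : Nonempty (⋃₀ c) := hne.to_subtype
      obtain ⟨y, hy⟩ := exists_surjective_nat (⋃₀ c)
      choose J hJ hyJ using fun n => Set.mem_sUnion.1 (y n).2
      refine ⟨⋃ n, J n, exists_peeling_iUnion fun n => hc (hJ n), fun s hs x hx => ?_⟩
      obtain ⟨n, hn⟩ := hy ⟨x, s, hs, hx⟩
      exact Set.mem_iUnion.2 ⟨n, by simpa [hn] using hyJ n⟩)
  obtain ⟨O, hO⟩ := hI.prop
  refine ⟨I, O, hO, fun v hv hfin => hv ?_⟩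
  exact hI.le_of_ge ⟨_, hO.insert hv (Set.not_infinite.1 (not_not.2 hfin))⟩
    (Set.subset_insert v I) (Set.mem_insert v I)

/-- A countably infinite set `S` has a numbering such that all infinite increasing paths in `S`
start in a fixed subset of `S` in which all degrees are infinite. -/
theorem SimpleGraph.exists_numbering {V : Type*} [Countable V] (G : SimpleGraph V)
    {S : Set V} (hS : S.Infinite) :
    ∃ (f : S ≃ ℕ) (W : Set V), W ⊆ S ∧ (∀ v ∈ W, {u | u ∈ W ∧ G.Adj v u}.Infinite) ∧
      ∀ p : ℕ → S, (∀ i, G.Adj (p i) (p (i + 1)) ∧ f (p i) < f (p (i + 1))) → (p 0 : V) ∈ W := by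
  have : Infinite S := hS.to_subtype
  obtain ⟨I, O, hO, hI⟩ := (G.induce S).exists_peeling_compl
  obtain ⟨f, hf⟩ := exists_equiv_nat_of_wellFounded_swap hO.finite hO.wf_swap
  refine ⟨f, Subtype.val '' Iᶜ, Subtype.coe_image_subset S _, ?_, ?_⟩
  · rintro _ ⟨v, hv, rfl⟩
    refine ((hI v hv).image Subtype.val_injective.injOn).mono ?_
    rintro _ ⟨u, ⟨hu, hvu⟩, rfl⟩
    exact ⟨⟨u, hu, rfl⟩, hvu⟩
  · intro p hp
    refine ⟨p 0, fun h0 => ?_, rfl⟩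
    have hback : ∀ i, p i ∈ I → O (p (i + 1)) (p i) := fun i hi =>
      (hO.total hi (show (G.induce S).Adj _ _ from (hp i).1)).resolve_left
        fun h => (hf _ _ h).not_gt (hp i).2
    have hmem : ∀ i, p i ∈ I := by
      intro i
      induction i with
      | zero => exact h0
      | succ i ih => exact hO.mem (hback i ih)
    exact hO.wf.no_descending_seq p fun i => hback i (hmem i)

/-- If all vertices of `W` have infinitely many neighbours in `W`, then every vertex of `W` starts
a path in `W` along which an injective `ℕ`-valued label increases. -/
theorem SimpleGraph.exists_increasing_path {V : Type*} (G : SimpleGraph V) {W : Set V}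
    (hW : ∀ v ∈ W, {u | u ∈ W ∧ G.Adj v u}.Infinite) {f : V → ℕ} (hf : Set.InjOn f W)
    {v : V} (hv : v ∈ W) :
    ∃ p : ℕ → V, p 0 = v ∧
      ∀ i, p i ∈ W ∧ G.Adj (p i) (p (i + 1)) ∧ f (p i) < f (p (i + 1)) := by
  have next : ∀ v : W, ∃ u : W, G.Adj v u ∧ f v < f u := by
    rintro ⟨v, hv⟩
    have hinf : (f '' {u | u ∈ W ∧ G.Adj v u}).Infinite :=
      (hW v hv).image (hf.mono fun u hu => hu.1)
    obtain ⟨_, ⟨u, ⟨hu, hvu⟩, rfl⟩, h⟩ := hinf.exists_gt (f v)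
    exact ⟨⟨u, hu⟩, hvu, h⟩
  choose s hs using next
  refine ⟨fun n => (s^[n] ⟨v, hv⟩ : W), rfl, fun i => ⟨Subtype.coe_prop _, ?_⟩⟩
  simp only [Function.iterate_succ_apply']
  exact hs _

theorem stmt11 {V : Type*} [Countable V] [Infinite V] (G : SimpleGraph V) :
    (∀ V₁ : Set V, V₁.Infinite → V₁ᶜ.Infinite →
      ∃ W₁ ⊆ V₁, ∃ W₂ ⊆ V₁ᶜ,
        (∀ v ∈ W₁, {u | u ∈ W₁ ∧ G.Adj v u}.Infinite) ∧
        (∀ v ∈ W₂, {u | u ∈ W₂ ∧ G.Adj v u}.Infinite) ∧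
        ∃ w₁ ∈ W₁, ∃ w₂ ∈ W₂, G.Adj w₁ w₂) ↔
    (∀ φ : V ≃ ℤ, InfIncrTwoSidedPath G (fun v => φ v)) := by
  classical
  constructor
  · intro h φ
    have hneg : {v | φ v < 0}.Infinite :=
      (Set.Iio_infinite (0 : ℤ)).preimage (f := φ) (by simp)
    have hpos : {v | φ v < 0}ᶜ.Infinite := by
      have : {v | φ v < 0}ᶜ = φ ⁻¹' Set.Ici 0 := by ext; simp
      rw [this]
      exact (Set.Ici_infinite (0 : ℤ)).preimage (by simp)
    obtain ⟨W₁, hW₁, W₂, hW₂, h₁, h₂, w₁, hw₁, w₂, hw₂, hw⟩ := h _ hneg hpos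
    have hW₁' : ∀ v ∈ W₁, φ v < 0 := fun v hv => hW₁ hv
    have hW₂' : ∀ v ∈ W₂, 0 ≤ φ v := fun v hv => not_lt.1 (hW₂ hv)
    obtain ⟨p, hp0, hp⟩ := G.exists_increasing_path h₁ (f := fun v => (-φ v).toNat)
      (fun v hv u hu huv => φ.injective (by
        have := hW₁' v hv; have := hW₁' u hu; simp only at huv; omega)) hw₁
    obtain ⟨q, hq0, hq⟩ := G.exists_increasing_path h₂ (f := fun v => (φ v).toNat)
      (fun v hv u hu huv => φ.injective (by
        have := hW₂' v hv; have := hW₂' u hu; simp only at huv; omega)) hw₂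
    let w : ℤ → V := fun i => if 0 ≤ i then q i.toNat else p (-i - 1).toNat
    have hstep : ∀ i : ℤ, G.Adj (w i) (w (i + 1)) ∧ φ (w i) < φ (w (i + 1)) := by
      intro i
      rcases lt_trichotomy i (-1) with hi | rfl | hi
      · obtain ⟨n, rfl⟩ : ∃ n : ℕ, i = -n - 2 := ⟨(-i - 2).toNat, by omega⟩
        have e1 : w (-n - 2) = p (n + 1) := by
          simp only [w, if_neg (show ¬ (0 : ℤ) ≤ -n - 2 by omega)]
          congr 1; omega
        have e2 : w (-n - 2 + 1) = p n := by
          simp only [w, if_neg (show ¬ (0 : ℤ) ≤ -n - 2 + 1 by omega)]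
          congr 1; omega
        obtain ⟨-, hadj, hlt⟩ := hp n
        rw [e1, e2]
        exact ⟨hadj.symm, by omega⟩
      · have e1 : w (-1) = w₁ := by simp [w, hp0]
        have e2 : w (-1 + 1) = w₂ := by simp [w, hq0]
        rw [e1, e2]
        exact ⟨hw, (hW₁' _ hw₁).trans_le (hW₂' _ hw₂)⟩
      · obtain ⟨n, rfl⟩ : ∃ n : ℕ, i = n := ⟨i.toNat, by omega⟩
        have e1 : w n = q n := by simp [w]
        have e2 : w (n + 1) = q (n + 1) := by
          simp only [w, if_pos (show (0 : ℤ) ≤ n + 1 by omega)]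
          congr 1
        obtain ⟨-, hadj, hlt⟩ := hq n
        rw [e1, e2]
        exact ⟨hadj, by omega⟩
    have hmono : StrictMono fun i => φ (w i) := strictMono_int_of_lt_succ fun i => (hstep i).2
    exact ⟨w, fun i j hij => hmono.injective (congrArg φ hij), hstep⟩
  · intro h V₁ hV₁ hV₂
    obtain ⟨f₁, W₁, hW₁, h₁, hf₁⟩ := G.exists_numbering hV₁
    obtain ⟨f₂, W₂, hW₂, h₂, hf₂⟩ := G.exists_numbering hV₂
    let φ : V ≃ ℤ := (((Equiv.sumComm _ _).trans (Equiv.Set.sumCompl V₁)).symm.trans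
      (Equiv.sumCongr f₂ f₁)).trans Equiv.intEquivNatSumNat.symm
    have hφ₁ : ∀ v : V₁, φ v = Int.negSucc (f₁ v) := by
      intro v
      simp only [φ, Equiv.trans_apply, Equiv.symm_trans_apply, Equiv.Set.sumCompl_symm_apply]
      rfl
    have hφ₂ : ∀ v : (V₁ᶜ : Set V), φ v = (f₂ v : ℤ) := by
      intro v
      simp only [φ, Equiv.trans_apply, Equiv.symm_trans_apply, Equiv.Set.sumCompl_symm_apply_compl]
      rfl
    have hneg : ∀ v, φ v < 0 → v ∈ V₁ := by
      intro v hv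
      by_contra hn
      have := hφ₂ ⟨v, hn⟩
      simp only at this
      omega
    have hpos : ∀ v, 0 ≤ φ v → v ∈ V₁ᶜ := by
      intro v hv hn
      have := hφ₁ ⟨v, hn⟩
      simp only at this
      omega
    obtain ⟨w, -, hw⟩ := h φ
    have hmono : StrictMono fun i => φ (w i) := strictMono_int_of_lt_succ fun i => (hw i).2
    -- the last vertex with a negative label
    obtain ⟨k, hk, hk'⟩ : ∃ k : ℤ, φ (w k) < 0 ∧ 0 ≤ φ (w (k + 1)) := by
      have hup : ∀ n : ℕ, φ (w 0) + n ≤ φ (w n) := by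
        intro n
        induction n with
        | zero => simp
        | succ n ih =>
          have : φ (w n) < φ (w (n + 1)) := (hw n).2
          push_cast
          omega
      have hdown : ∀ n : ℕ, φ (w (-n)) ≤ φ (w 0) - n := by
        intro n
        induction n with
        | zero => simp
        | succ n ih =>
          have := (hw (-(n + 1 : ℕ))).2
          rw [show (-((n + 1 : ℕ) : ℤ) + 1) = -n by push_cast; ring] at this
          push_cast at this ⊢
          omega
      have hbdd : ∀ i, φ (w i) < 0 → i ≤ (φ (w 0)).natAbs := by
        intro i hi
        by_contra! hlt
        have h1 := hmono hlt
        have h2 := hup (φ (w 0)).natAbs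
        simp only at h1
        omega
      obtain ⟨k, hk, hmax⟩ := Int.exists_greatest_of_bdd (P := fun i => φ (w i) < 0) ⟨_, hbdd⟩
        ⟨-((φ (w 0)).natAbs + 1 : ℕ), by
          have := hdown ((φ (w 0)).natAbs + 1)
          have habs := le_abs_self (φ (w 0))
          push_cast at this ⊢
          linarith⟩
      refine ⟨k, hk, not_lt.1 fun hlt => ?_⟩
      have := hmax _ hlt
      omega
    have hmem₁ : ∀ i : ℕ, w (k - i) ∈ V₁ := fun i =>
      hneg _ ((hmono.monotone (by omega)).trans_lt hk)
    have hmem₂ : ∀ i : ℕ, w (k + 1 + i) ∈ V₁ᶜ := fun i =>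
      hpos _ (hk'.trans (hmono.monotone (by omega)))
    have hw₁ := hf₁ (fun i => ⟨w (k - i), hmem₁ i⟩) (by
      intro i
      obtain ⟨hadj, hlt⟩ := hw (k - (i + 1 : ℕ))
      rw [show k - ((i + 1 : ℕ) : ℤ) + 1 = k - i by push_cast; ring] at hadj hlt
      refine ⟨hadj.symm, ?_⟩
      have e1 := hφ₁ ⟨_, hmem₁ i⟩
      have e2 := hφ₁ ⟨_, hmem₁ (i + 1)⟩
      simp only at e1 e2 hlt
      omega)
    have hw₂ := hf₂ (fun i => ⟨w (k + 1 + i), hmem₂ i⟩) (by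
      intro i
      obtain ⟨hadj, hlt⟩ := hw (k + 1 + i)
      rw [show k + 1 + (i : ℤ) + 1 = k + 1 + (i + 1 : ℕ) by push_cast; ring] at hadj hlt
      refine ⟨hadj, ?_⟩
      have e1 := hφ₂ ⟨_, hmem₂ i⟩
      have e2 := hφ₂ ⟨_, hmem₂ (i + 1)⟩
      simp only at e1 e2 hlt
      omega)
    refine ⟨W₁, hW₁, W₂, hW₂, h₁, h₂, w k, by simpa using hw₁, w (k + 1), by simpa using hw₂,
      (hw k).1⟩
end

section
/- For a countable directed graph D=(V,E) the following are equivalent: (1) there exists a nonempty set W ⊆ V such that every v ∈ W has infinite out-degree in W; (2) for every bijection φ: V → ℕ there exists an infinite increasing directed path in D; (3) for every injection φ: E → ℕ there exists an infinite sequence of pairwise distinct vertices v_1, v_2, ... with each f_i = (v_i, v_{i+1}) ∈ E and φ(f_i) < φ(f_{i+1}) for all i ≥ 1. -/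
/-- If every nonempty set `W` of vertices has an element of finite out-degree in `W`, then the
vertices can be well-ordered so that each of them has only finitely many larger out-neighbours. -/
theorem exists_ordinal_rank_finite_forward.{u} {V : Type u} (E : Set (V × V))
    (h : ∀ W : Set V, W.Nonempty → ∃ v ∈ W, {u | u ∈ W ∧ (v, u) ∈ E}.Finite) :
    ∃ r : V → Ordinal.{u}, Function.Injective r ∧ ∀ v, {u | (v, u) ∈ E ∧ r v < r u}.Finite := by
  rcases isEmpty_or_nonempty V with hV | hV
  · exact ⟨fun _ => 0, fun a => isEmptyElim a, fun a => isEmptyElim a⟩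
  choose! c hc hfin using h
  obtain ⟨A, hA⟩ : ∃ A : Ordinal.{u} → V, ∀ α, A α = c {v | ∀ β < α, A β ≠ v} := by
    refine ⟨WellFounded.fix (Ordinal.lt_wf)
      (fun α ih => c {v | ∀ β (hβ : β < α), ih β hβ ≠ v}), fun α => ?_⟩
    rw [WellFounded.fix_eq]
  have hex : ∃ α, {v | ∀ β < α, A β ≠ v} = ∅ := by
    by_contra! hne
    refine not_injective_of_ordinal A fun α β hαβ => ?_
    have key : ∀ α β, α < β → A α ≠ A β := fun α β hlt => by
      have := hc _ (hne β)
      rw [← hA] at this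
      exact this α hlt
    rcases lt_trichotomy α β with hlt | heq | hlt
    · exact (key _ _ hlt hαβ).elim
    · exact heq
    · exact (key _ _ hlt hαβ.symm).elim
  obtain ⟨α, hα, hmin⟩ := WellFounded.has_min Ordinal.lt_wf
    {α | {v | ∀ β < α, A β ≠ v} = ∅} hex
  have hsurj : ∀ v, ∃ β, β < α ∧ A β = v := fun v => by
    by_contra! hv
    exact (Set.eq_empty_iff_forall_notMem.1 hα v) hv
  have hr : ∀ v, ∃ β, (β < α ∧ A β = v) ∧ ∀ γ, A γ = v → β ≤ γ := fun v => by
    obtain ⟨β, hβ, hm⟩ := WellFounded.has_min Ordinal.lt_wf {β | β < α ∧ A β = v} (hsurj v)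
    refine ⟨β, hβ, fun γ hγ => not_lt.1 fun hlt => hm γ ⟨hlt.trans hβ.1, hγ⟩ hlt⟩
  choose r hr1 hr2 using hr
  refine ⟨r, fun u v huv => ?_, fun v => ?_⟩
  · rw [← (hr1 u).2, huv, (hr1 v).2]
  · have hne : {u | ∀ β < r v, A β ≠ u}.Nonempty :=
      Set.nonempty_iff_ne_empty.2 fun h0 => hmin _ h0 (hr1 v).1
    have hf := hfin _ hne
    rw [← hA, (hr1 v).2] at hf
    exact hf.subset fun u hu => ⟨fun β hβ he => ((hr2 u β he).trans_lt hβ).not_gt hu.2, hu.1⟩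

/-- A finitely branching relation along which a natural number decreases reaches only finitely
many elements from a given one. -/
theorem finite_reflTransGen_of_measure {α : Type*} {R : α → α → Prop} (μ : α → ℕ)
    (hμ : ∀ a b, R a b → μ b < μ a) (hfin : ∀ a, {b | R a b}.Finite) (a : α) :
    {b | Relation.ReflTransGen R a b}.Finite := by
  induction hn : μ a using Nat.strong_induction_on generalizing a with
  | _ n ih =>
    refine (((hfin a).biUnion fun b hb => ih (μ b) (hn ▸ hμ a b hb) b rfl).insert a).subset ?_
    intro d hd
    rcases Relation.ReflTransGen.cases_head hd with rfl | ⟨b, hab, hbd⟩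
    · exact Set.mem_insert _ _
    · exact Set.mem_insert_of_mem _ (Set.mem_biUnion (show b ∈ {b | R a b} from hab) hbd)

/-- A finite set `Q` has a finite superset that is closed under all forward edges passing over an
element of `Q`. -/
theorem exists_finite_superset_closed_crossing {V ι : Type*} [LinearOrder ι] (r : V → ι)
    (F : V → Set V) (hF : ∀ v, (F v).Finite) (Q : Set V) (hQ : Q.Finite) :
    ∃ P : Set V, P.Finite ∧ Q ⊆ P ∧
      ∀ c ∈ P, ∀ d ∈ F c, ∀ q ∈ Q, r c ≤ r q → r q < r d → d ∈ P := by
  let R : V → V → Prop := fun c d => d ∈ F c ∧ ∃ q ∈ Q, r c ≤ r q ∧ r q < r d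
  refine ⟨⋃ q ∈ Q, {d | Relation.ReflTransGen R q d}, hQ.biUnion fun q _ => ?_, ?_, ?_⟩
  · refine finite_reflTransGen_of_measure (fun c => {q | q ∈ Q ∧ r c ≤ r q}.ncard) ?_
      (fun c => (hF c).subset fun d hd => hd.1) q
    rintro c d ⟨-, q, hq, hcq, hqd⟩
    refine Set.ncard_lt_ncard ?_ (hQ.subset fun x hx => hx.1)
    have hsub : {q | q ∈ Q ∧ r d ≤ r q} ⊆ {q | q ∈ Q ∧ r c ≤ r q} := fun x hx =>
      ⟨hx.1, (hcq.trans_lt hqd).le.trans hx.2⟩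
    exact (Set.ssubset_iff_of_subset hsub).2 ⟨q, ⟨hq, hcq⟩, fun hx => hqd.not_ge hx.2⟩
  · exact fun q hq => Set.mem_biUnion hq Relation.ReflTransGen.refl
  · intro c hc d hd q hq hcq hqd
    obtain ⟨p, hp, hpc⟩ := Set.mem_iUnion₂.1 hc
    exact Set.mem_biUnion hp (Relation.ReflTransGen.tail hpc ⟨hd, q, hq, hcq, hqd⟩)

/-- A countable set is exhausted by finite sets `P n`, such that forward edges leaving `P (n + 1)`
pass over no element of `Q n ⊇ P n`, and forward edges from `P n` end in `Q n`. -/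
theorem exists_finite_exhaustion {V ι : Type*} [Countable V] [Nonempty V] [LinearOrder ι]
    (r : V → ι) (F : V → Set V) (hF : ∀ v, (F v).Finite) :
    ∃ P Q : ℕ → Set V, P 0 = ∅ ∧ (∀ n, (P n).Finite) ∧ (∀ n, P n ⊆ Q n) ∧
      (∀ n, Q n ⊆ P (n + 1)) ∧ (∀ v, ∃ n, v ∈ P n) ∧ (∀ n, ∀ c ∈ P n, F c ⊆ Q n) ∧
      ∀ n, ∀ c ∈ P (n + 1), ∀ d ∈ F c, ∀ q ∈ Q n, r c ≤ r q → r q < r d → d ∈ P (n + 1) := by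
  obtain ⟨e, he⟩ := exists_surjective_nat V
  choose! cl hcl_fin hcl_sub hcl using exists_finite_superset_closed_crossing r F hF
  let next : ℕ → Set V → Set V := fun n P => insert (e n) (P ∪ ⋃ v ∈ P, F v)
  let P : ℕ → Set V := fun n => Nat.rec ∅ (fun n P => cl (next n P)) n
  have hnext : ∀ n S, S.Finite → (next n S).Finite := fun n S hS =>
    (hS.union (hS.biUnion fun v _ => hF v)).insert _
  have hP : ∀ n, (P n).Finite := fun n => by
    induction n with
    | zero => exact Set.finite_empty
    | succ n ih => exact hcl_fin _ (hnext n _ ih)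
  have hsub : ∀ n, next n (P n) ⊆ P (n + 1) := fun n => hcl_sub _ (hnext n _ (hP n))
  refine ⟨P, fun n => next n (P n), rfl, hP, fun n v hv => Or.inr (Or.inl hv), hsub, ?_, ?_, ?_⟩
  · intro v
    obtain ⟨n, rfl⟩ := he v
    exact ⟨n + 1, hsub n (Or.inl rfl)⟩
  · exact fun n c hc d hd => Or.inr (Or.inr (Set.mem_biUnion hc hd))
  · exact fun n => hcl _ (hnext n _ (hP n))

/-- A linearly ordered key with finite initial segments can be replaced by a natural number. -/
theorem exists_nat_lt_iff_of_finite_initial {V κ : Type*} [LinearOrder κ] (k : V → κ)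
    (hfin : ∀ v, {u | k u < k v}.Finite) :
    ∃ f : V → ℕ, ∀ u v, f u < f v ↔ k u < k v := by
  have hlt : ∀ u v, k u < k v → {x | k x < k u}.ncard < {x | k x < k v}.ncard := fun u v h =>
    Set.ncard_lt_ncard ((Set.ssubset_iff_of_subset fun x hx => lt_trans hx h).2
      ⟨u, h, fun hx => lt_irrefl _ hx⟩) (hfin v)
  refine ⟨fun v => {u | k u < k v}.ncard, fun u v => ⟨fun h => ?_, hlt u v⟩⟩
  rcases lt_trichotomy (k u) (k v) with h1 | h1 | h1
  · exact h1
  · simp only [h1, lt_irrefl] at h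
  · exact (lt_asymm h (hlt v u h1)).elim

theorem exists_injective_forall_not_increasing_path {V : Type*} [Countable V] [Nonempty V]
    (E : Set (V × V))
    (h : ¬ ∃ W : Set V, W.Nonempty ∧ ∀ v ∈ W, {u | u ∈ W ∧ (v, u) ∈ E}.Infinite) :
    ∃ f : V → ℕ, Function.Injective f ∧
      ∀ w : ℕ → V, ¬ ∀ i, (w i, w (i + 1)) ∈ E ∧ f (w i) < f (w (i + 1)) := by
  classical
  obtain ⟨r, hr, hF⟩ := exists_ordinal_rank_finite_forward E fun W hW => by
    by_contra! hcon
    exact h ⟨W, hW, hcon⟩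
  obtain ⟨P, Q, hP0, hPfin, hPQ, hQP, hcov, hPF, hcross⟩ := exists_finite_exhaustion r _ hF
  have hPmono : Monotone P := monotone_nat_of_le_succ fun n => (hPQ n).trans (hQP n)
  have hQmono : Monotone Q := monotone_nat_of_le_succ fun n => (hQP n).trans (hPQ (n + 1))
  have hb : ∀ v, ∃ n, v ∈ P (n + 1) ∧ v ∉ P n := fun v => by
    have hpos : Nat.find (hcov v) ≠ 0 := fun h0 => by
      have := Nat.find_spec (hcov v)
      rw [h0, hP0] at this
      exact this
    obtain ⟨n, hn⟩ := Nat.exists_eq_succ_of_ne_zero hpos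
    have hspec := Nat.find_spec (hcov v)
    rw [hn] at hspec
    exact ⟨n, hspec, Nat.find_min (hcov v) (hn ▸ n.lt_succ_self)⟩
  choose b hb1 hb2 using hb
  have hble : ∀ v n, v ∈ P (n + 1) → b v ≤ n := fun v n hv =>
    not_lt.1 fun hlt => hb2 v (hPmono (Nat.succ_le_of_lt hlt) hv)
  let k : V → ℕ ×ₗ Ordinalᵒᵈ := fun v => toLex (b v, OrderDual.toDual (r v))
  have hk : ∀ u v, k u < k v ↔ b u < b v ∨ b u = b v ∧ r v < r u := fun u v => by
    simp only [k, Prod.Lex.toLex_lt_toLex, OrderDual.toDual_lt_toDual]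
  obtain ⟨f, hf⟩ := exists_nat_lt_iff_of_finite_initial k fun v =>
    (hPfin (b v + 1)).subset fun u hu => hPmono
      (Nat.succ_le_succ (by rcases (hk u v).1 hu with h1 | h1 <;> omega)) (hb1 u)
  have hkinj : Function.Injective k := fun u v huv => by
    apply hr
    simpa [k] using congrArg (fun x => (ofLex x).2) huv
  refine ⟨f, fun u v huv => hkinj ?_, fun w hw => ?_⟩
  · exact le_antisymm (not_lt.1 fun hlt => ((hf _ _).2 hlt).ne' huv)
      (not_lt.1 fun hlt => ((hf _ _).2 hlt).ne huv)
  have hwk : ∀ i, b (w i) < b (w (i + 1)) ∨ b (w i) = b (w (i + 1)) ∧ r (w (i + 1)) < r (w i) :=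
    fun i => (hk _ _).1 ((hf _ _).1 (hw i).2)
  have hbmono : Monotone fun i => b (w i) := monotone_nat_of_le_succ fun i => by
    rcases hwk i with h1 | h1
    · exact h1.le
    · exact h1.1.le
  have hfmono : StrictMono fun i => f (w i) := strictMono_nat_of_lt_succ fun i => (hw i).2
  have hforward : ∀ i, r (w i) < r (w (i + 1)) → b (w i) < b (w (i + 1)) ∧
      w (i + 1) ∈ Q (b (w i) + 1) ∧
      ∀ q ∈ Q (b (w i)), r (w i) ≤ r q → r (w (i + 1)) ≤ r q := fun i hi => by
    have hlt : b (w i) < b (w (i + 1)) := (hwk i).resolve_right fun h1 => lt_asymm h1.2 hi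
    refine ⟨hlt, hPF _ _ (hb1 (w i)) ⟨(hw i).1, hi⟩, fun q hq hle => not_lt.1 fun hqd => ?_⟩
    exact hlt.not_ge (hble _ _ (hcross _ _ (hb1 (w i)) _ ⟨(hw i).1, hi⟩ q hq hle hqd))
  have hbound : ∀ i, r (w i) < r (w (i + 1)) → ∀ j, i + 1 ≤ j → r (w j) ≤ r (w (i + 1)) := by
    intro i hi j hj
    induction j, hj using Nat.le_induction with
    | base => exact le_rfl
    | succ j hj ih =>
      rcases le_or_gt (r (w (j + 1))) (r (w j)) with h1 | h1
      · exact h1.trans ih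
      · obtain ⟨hlt, hQ, -⟩ := hforward i hi
        exact (hforward j h1).2.2 _
          (hQmono ((Nat.succ_le_of_lt hlt).trans (hbmono hj)) hQ) ih
  have hex : ∀ n, ∃ i, n ≤ i ∧ r (w i) < r (w (i + 1)) := fun n => by
    by_contra! hcon
    refine (RelEmbedding.wellFounded_iff_isEmpty.1 Ordinal.lt_wf).elim
      (RelEmbedding.natGT (fun m => r (w (n + m))) fun m => ?_)
    refine lt_of_le_of_ne (hcon (n + m) (Nat.le_add_right _ _)) fun heq => ?_
    exact (hw (n + m)).2.ne' (congrArg f (hr heq))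
  obtain ⟨d, ⟨i, hi, rfl⟩, hmin⟩ := WellFounded.has_min Ordinal.lt_wf
    {d | ∃ i, r (w i) < r (w (i + 1)) ∧ r (w (i + 1)) = d}
    (let ⟨i, _, hi⟩ := hex 0; ⟨_, i, hi, rfl⟩)
  obtain ⟨j, hj, hjlt⟩ := hex (i + 1)
  refine hmin _ ⟨j, hjlt, rfl⟩ (lt_of_le_of_ne (hbound i hi (j + 1) (by omega)) fun heq => ?_)
  exact (hfmono (show i + 1 < j + 1 by omega)).ne' (congrArg f (hr heq))

/-- An injective labelling by natural numbers of an infinite type can be compressed to a bijective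
one inducing the same order. -/
theorem exists_equiv_nat_lt_iff {V : Type*} [Infinite V] (f : V → ℕ)
    (hf : Function.Injective f) : ∃ φ : V ≃ ℕ, ∀ u v, φ u < φ v ↔ f u < f v := by
  classical
  have : Infinite (Set.range f) := (Set.infinite_range_of_injective hf).to_subtype
  refine ⟨(Equiv.ofInjective f hf).trans (Nat.Subtype.orderIsoOfNat (Set.range f)).symm.toEquiv,
    fun u v => ?_⟩
  exact (Nat.Subtype.orderIsoOfNat (Set.range f)).symm.lt_iff_lt

theorem lt_of_pair_lt_pair {a b c : ℕ} (hne : b ≠ c) (h : Nat.pair b a < Nat.pair c b) :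
    b < c := by
  by_contra! hle
  have hcb : c < b := lt_of_le_of_ne hle hne.symm
  unfold Nat.pair at h
  rw [if_pos hcb] at h
  split_ifs at h with h1
  · nlinarith
  · omega

theorem exists_increasing_vertex_path {V : Type*} {E : Set (V × V)} {W : Set V}
    (hne : W.Nonempty) (hW : ∀ v ∈ W, {u | u ∈ W ∧ (v, u) ∈ E}.Infinite) (φ : V → ℕ)
    (hφ : Function.Injective φ) :
    ∃ w : ℕ → V, Function.Injective w ∧
      ∀ i, (w i, w (i + 1)) ∈ E ∧ φ (w i) < φ (w (i + 1)) := by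
  obtain ⟨v₀, hv₀⟩ := hne
  have hstep : ∀ v : W, ∃ u : W, (v.1, u.1) ∈ E ∧ φ v < φ u := fun v => by
    obtain ⟨u, hu, hlt⟩ := ((hW v v.2).image hφ.injOn).exists_gt (φ v)
    obtain ⟨x, hx, rfl⟩ := hu
    exact ⟨⟨x, hx.1⟩, hx.2, hlt⟩
  choose s hs using hstep
  let w : ℕ → W := fun n => s^[n] ⟨v₀, hv₀⟩
  have hw : ∀ i, w (i + 1) = s (w i) := fun i => Function.iterate_succ_apply' s i _
  have hp : ∀ i, ((w i).1, (w (i + 1)).1) ∈ E ∧ φ (w i) < φ (w (i + 1)) := fun i => by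
    rw [hw]
    exact hs (w i)
  have hmono : StrictMono fun i => φ (w i) := strictMono_nat_of_lt_succ fun i => (hp i).2
  exact ⟨fun i => w i, fun i j hij => hmono.injective (congrArg φ hij), hp⟩

theorem exists_increasing_edge_path {V : Type*} {E : Set (V × V)} {W : Set V}
    (hne : W.Nonempty) (hW : ∀ v ∈ W, {u | u ∈ W ∧ (v, u) ∈ E}.Infinite) (φ : V × V → ℕ)
    (hφ : Set.InjOn φ E) :
    ∃ w : ℕ → V, Function.Injective w ∧ (∀ i, (w i, w (i + 1)) ∈ E) ∧
      ∀ i, φ (w i, w (i + 1)) < φ (w (i + 1), w (i + 2)) := by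
  classical
  obtain ⟨v₀, hv₀⟩ := hne
  have hstep : ∀ (v : W) (S : Finset V) (m : ℕ), ∃ u : W, (v.1, u.1) ∈ E ∧ u.1 ∉ S ∧
      m < φ (v, u) := fun v S m => by
    have hinf := (hW v v.2).sdiff S.finite_toSet
    have hinj : Set.InjOn (fun u => φ (v.1, u)) ({u | u ∈ W ∧ (v.1, u) ∈ E} \ S) :=
      fun x hx y hy hxy => (Prod.ext_iff.1 (hφ hx.1.2 hy.1.2 hxy)).2
    obtain ⟨_, ⟨x, hx, rfl⟩, hlt⟩ := (hinf.image hinj).exists_gt m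
    exact ⟨⟨x, hx.1.1⟩, hx.1.2, hx.2, hlt⟩
  choose s hsE hsS hsm using hstep
  -- A state holds the current vertex, the set of visited vertices and the last edge label.
  let next : W × Finset V × ℕ → W × Finset V × ℕ := fun x =>
    (s x.1 x.2.1 x.2.2, insert (s x.1 x.2.1 x.2.2).1 x.2.1, φ (x.1, s x.1 x.2.1 x.2.2))
  let st : ℕ → W × Finset V × ℕ := fun n => next^[n] (⟨v₀, hv₀⟩, {v₀}, 0)
  have hst : ∀ i, st (i + 1) = next (st i) := fun i => Function.iterate_succ_apply' next i _
  have hmem : ∀ i, (st i).1.1 ∈ (st i).2.1 := fun i => by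
    cases i with
    | zero => exact Finset.mem_singleton_self _
    | succ i => rw [hst]; exact Finset.mem_insert_self _ _
  have hmono : Monotone fun i => (st i).2.1 := monotone_nat_of_le_succ fun i => by
    simp only [hst]
    exact Finset.subset_insert _ _
  have hnew : ∀ i j, i < j → (st i).1.1 ≠ (st j).1.1 := fun i j hij heq => by
    obtain ⟨j, rfl⟩ : ∃ l, j = l + 1 := ⟨j - 1, by omega⟩
    have h1 : (st i).1.1 ∈ (st j).2.1 := hmono (Nat.le_of_lt_succ hij) (hmem i)
    rw [heq, hst] at h1
    exact hsS _ _ _ h1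
  refine ⟨fun i => (st i).1, fun i j hij => ?_, fun i => ?_, fun i => ?_⟩
  · rcases lt_trichotomy i j with h1 | h1 | h1
    · exact (hnew i j h1 hij).elim
    · exact h1
    · exact (hnew j i h1 hij.symm).elim
  · simp only [hst]
    exact hsE _ _ _
  · have h1 : (st (i + 1)).2.2 = φ ((st i).1, (st (i + 1)).1) := by rw [hst]
    have h2 := hsm (st (i + 1)).1 (st (i + 1)).2.1 (st (i + 1)).2.2
    rw [h1] at h2
    have h3 : (st (i + 2)).1 = s (st (i + 1)).1 (st (i + 1)).2.1 (st (i + 1)).2.2 := by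
      rw [hst (i + 1)]
    rw [h1] at h3
    simpa only [h3] using h2

theorem stmt14 {V : Type*} [Countable V] [Infinite V] (E : Set (V × V)) :
    ((∃ W : Set V, W.Nonempty ∧ ∀ v ∈ W, {u | u ∈ W ∧ (v, u) ∈ E}.Infinite) ↔
      (∀ φ : V ≃ ℕ, ∃ w : ℕ → V, Function.Injective w ∧
        ∀ i, (w i, w (i + 1)) ∈ E ∧ φ (w i) < φ (w (i + 1)))) ∧
    ((∃ W : Set V, W.Nonempty ∧ ∀ v ∈ W, {u | u ∈ W ∧ (v, u) ∈ E}.Infinite) ↔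
      (∀ φ : V × V → ℕ, Set.InjOn φ E →
        ∃ w : ℕ → V, Function.Injective w ∧ (∀ i, (w i, w (i + 1)) ∈ E) ∧
          ∀ i, φ (w i, w (i + 1)) < φ (w (i + 1), w (i + 2)))) := by
  refine ⟨⟨fun ⟨W, hne, hW⟩ φ => exists_increasing_vertex_path hne hW φ φ.injective,
    fun h => ?_⟩, ⟨fun ⟨W, hne, hW⟩ φ hφ => exists_increasing_edge_path hne hW φ hφ,
    fun h => ?_⟩⟩
  · by_contra hcon
    obtain ⟨f, hf, hno⟩ := exists_injective_forall_not_increasing_path E hcon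
    obtain ⟨φ, hφ⟩ := exists_equiv_nat_lt_iff f hf
    obtain ⟨w, -, hw⟩ := h φ
    exact hno w fun i => ⟨(hw i).1, (hφ _ _).1 (hw i).2⟩
  · by_contra hcon
    obtain ⟨f, hf, hno⟩ := exists_injective_forall_not_increasing_path E hcon
    obtain ⟨w, hinj, hE, hw⟩ := h (fun e => Nat.pair (f e.2) (f e.1)) fun x _ y _ hxy => by
      obtain ⟨h2, h1⟩ := Nat.pair_eq_pair.1 hxy
      exact Prod.ext (hf h1) (hf h2)
    refine hno (fun i => w (i + 1)) fun i => ⟨hE (i + 1), lt_of_pair_lt_pair ?_ (hw i)⟩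
    exact fun heq => absurd (hinj (hf heq)) (by omega)
end

section
/- For a countable directed graph D=(V,E) the following are equivalent: (1) for every partition of V into two infinite sets V_1, V_2 there exist W_1 ⊆ V_1 and W_2 ⊆ V_2 such that every v ∈ W_1 has infinite out-degree in W_1, every v ∈ W_2 has infinite in-degree in W_2, and there exist w_1 ∈ W_1 and w_2 ∈ W_2 with (w_2, w_1) ∈ E; (2) for every bijection φ: V → ℤ there exists an infinite increasing two-sided directed path in D. -/
universe u

theorem exists_orderIso_nat {X : Type*} [LinearOrder X] [Infinite X]
    (h : ∀ x : X, (Set.Iic x).Finite) : Nonempty (X ≃o ℕ) := by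
  classical
  let _ : LocallyFiniteOrder X :=
    LocallyFiniteOrder.ofFiniteIcc fun a b => (h b).subset fun _ hx => hx.2
  let _ : SuccOrder X := LinearLocallyFiniteOrder.succOrder X
  let _ : PredOrder X := LinearLocallyFiniteOrder.predOrder X
  have : NoMaxOrder X := ⟨fun a => by
    by_contra! hc
    exact Set.infinite_univ ((h a).subset fun x _ => hc x)⟩
  obtain ⟨b, -, hb⟩ := Set.exists_min_image (Set.Iic (Classical.arbitrary X)) id (h _) ⟨_, le_rfl⟩
  let _ : OrderBot X :=
    { bot := b
      bot_le := fun x => (le_total x (Classical.arbitrary X)).elim (hb x)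
        fun hx => (hb _ le_rfl).trans hx }
  exact ⟨orderIsoNatOfLinearSuccPredArch⟩

/-- `Removable N α v` says that all but finitely many out-neighbours of `v` are removable at a
stage before `α`. -/
inductive Removable {X : Type u} (N : X → X → Prop) : Ordinal.{u} → X → Prop
  | intro (α : Ordinal.{u}) (v : X) (S : Set X) (b : X → Ordinal.{u}) (hS : S.Finite)
      (hb : ∀ u, N v u → u ∉ S → b u < α) (hr : ∀ u, N v u → u ∉ S → Removable N (b u) u) :
      Removable N α v

theorem exists_rank {X : Type u} (N : X → X → Prop) :
    ∃ ρ : X → WithTop Ordinal.{u},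
      (∀ v, ρ v ≠ ⊤ → {u | N v u ∧ ρ v ≤ ρ u}.Finite) ∧
      (∀ v, ρ v = ⊤ → {u | N v u ∧ ρ u = ⊤}.Infinite) := by
  classical
  let ρ : X → WithTop Ordinal.{u} := fun v =>
    if ∃ α, Removable N α v then ((sInf {α | Removable N α v} : Ordinal.{u}) : WithTop _) else ⊤
  have htop : ∀ v, ρ v = ⊤ ↔ ¬ ∃ α, Removable N α v := by
    intro v
    by_cases h : ∃ α, Removable N α v <;> simp only [ρ, h] <;> simp
  have hle : ∀ v α, Removable N α v → ρ v ≤ α := by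
    intro v α h
    simp only [ρ, if_pos (⟨α, h⟩ : ∃ α, Removable N α v)]
    exact WithTop.coe_le_coe.2 (csInf_le' h)
  refine ⟨ρ, fun v hv => ?_, fun v hv hfin => ?_⟩
  · have hex : ∃ α, Removable N α v := by
      by_contra h
      exact hv ((htop v).2 h)
    have hmem : Removable N (sInf {α | Removable N α v}) v := csInf_mem hex
    have hρ : ρ v = (sInf {α | Removable N α v} : Ordinal.{u}) := by
      simp only [ρ, if_pos hex]
    generalize sInf {α | Removable N α v} = α at hmem hρ
    obtain ⟨_, _, S, b, hS, hb, hr⟩ := hmem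
    refine hS.subset fun u ⟨hu, hvu⟩ => ?_
    by_contra huS
    rw [hρ] at hvu
    exact absurd (hvu.trans (hle u _ (hr u hu huS))) (not_le.2 (WithTop.coe_lt_coe.2 (hb u hu huS)))
  · refine (htop v).1 hv ?_
    let b : X → Ordinal.{u} := fun u => sInf {α | Removable N α u}
    refine ⟨Order.succ (⨆ u, b u), .intro _ v _ b hfin (fun u _ _ => ?_) fun u hu huS => ?_⟩
    · exact Order.lt_succ_of_le (le_ciSup Ordinal.bddAbove_of_small u)
    · have : ∃ α, Removable N α u := by
        by_contra h
        exact huS ⟨hu, (htop u).2 h⟩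
      exact csInf_mem this

theorem exists_finset_closed {X : Type*} (r : X → X → Prop) (c : X → ℕ) (n : ℕ)
    (hc : ∀ a b, r a b → c a < c b) (hn : ∀ a, c a ≤ n) (hr : ∀ a, {b | r a b}.Finite)
    (S : Finset X) : ∃ s : Finset X, S ⊆ s ∧ ∀ a ∈ s, ∀ b, r a b → b ∈ s := by
  classical
  have key : ∀ m x, n - c x < m → ∃ s : Finset X, x ∈ s ∧ ∀ a ∈ s, ∀ b, r a b → b ∈ s := by
    intro m
    induction m with
    | zero => intro x hx; omega
    | succ m ih =>
      intro x hx
      have : ∀ y, ∃ s : Finset X, r x y → y ∈ s ∧ ∀ a ∈ s, ∀ b, r a b → b ∈ s := by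
        intro y
        by_cases hxy : r x y
        · obtain ⟨s, hs⟩ := ih y (by have := hc x y hxy; have := hn y; omega)
          exact ⟨s, fun _ => hs⟩
        · exact ⟨∅, fun h => absurd h hxy⟩
      choose t ht using this
      refine ⟨insert x ((hr x).toFinset.biUnion t), Finset.mem_insert_self _ _, fun a ha b hab => ?_⟩
      simp only [Finset.mem_insert, Finset.mem_biUnion, Set.Finite.mem_toFinset,
        Set.mem_ofPred_eq] at ha ⊢
      rcases ha with rfl | ⟨y, hy, hay⟩
      · exact .inr ⟨b, hab, (ht b hab).1⟩
      · exact .inr ⟨y, hy, (ht y hy).2 a hay b hab⟩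
  choose t ht using fun x => key _ x (Nat.lt_succ_self _)
  refine ⟨S.biUnion t, fun x hx => Finset.mem_biUnion.2 ⟨x, hx, (ht x).1⟩, fun a ha b hab => ?_⟩
  obtain ⟨x, hx, hax⟩ := Finset.mem_biUnion.1 ha
  exact Finset.mem_biUnion.2 ⟨x, hx, (ht x).2 a hax b hab⟩

theorem exists_finset_not_crossing {X L : Type*} [LinearOrder L] (F : X → Finset X) (ρ : X → L)
    (R : Finset L) (S : Finset X) :
    ∃ s : Finset X, S ⊆ s ∧ ∀ a ∈ s, ∀ b ∈ F a, b ∉ s → ∀ α ∈ R,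
      (ρ a < α → ρ b < α) ∧ (ρ a ≤ α → ρ b ≤ α) := by
  classical
  obtain ⟨s, hS, hs⟩ := exists_finset_closed
    (fun a b => b ∈ F a ∧ ∃ α ∈ R, ρ a < α ∧ α ≤ ρ b ∨ ρ a ≤ α ∧ α < ρ b)
    (fun x => (R.filter (· < ρ x)).card + (R.filter (· ≤ ρ x)).card) (R.card + R.card)
    (by
      rintro a b ⟨-, α, hα, h⟩
      have hab : ρ a < ρ b := by
        rcases h with h | h
        · exact h.1.trans_le h.2
        · exact h.1.trans_lt h.2
      have h₁ : R.filter (· < ρ a) ⊆ R.filter (· < ρ b) :=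
        Finset.monotone_filter_right _ fun x _ hx => lt_trans hx hab
      have h₂ : R.filter (· ≤ ρ a) ⊆ R.filter (· ≤ ρ b) :=
        Finset.monotone_filter_right _ fun x _ hx => le_trans hx hab.le
      rcases h with h | h
      · refine add_lt_add_of_le_of_lt (Finset.card_le_card h₁) (Finset.card_lt_card ?_)
        refine Finset.ssubset_iff_of_subset h₂ |>.2 ⟨α, ?_, ?_⟩ <;> simp [hα, h]
      · refine add_lt_add_of_lt_of_le (Finset.card_lt_card ?_) (Finset.card_le_card h₂)
        refine Finset.ssubset_iff_of_subset h₁ |>.2 ⟨α, ?_, ?_⟩ <;> simp [hα, h])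
    (fun a => add_le_add (Finset.card_filter_le _ _) (Finset.card_filter_le _ _))
    (fun a => (F a).finite_toSet.subset fun b hb => hb.1) S
  refine ⟨s, hS, fun a ha b hb hbs α hα => ⟨fun h => ?_, fun h => ?_⟩⟩ <;> by_contra! hc
  · exact hbs (hs a ha b ⟨hb, α, hα, .inl ⟨h, hc⟩⟩)
  · exact hbs (hs a ha b ⟨hb, α, hα, .inr ⟨h, hc⟩⟩)

theorem exists_equiv_nat_lt_iff_s16 {X K : Type*} [LinearOrder K] [Infinite X] (g : X → K)
    (hg : Function.Injective g) (h : ∀ x : X, {y | g y ≤ g x}.Finite) :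
    ∃ φ : X ≃ ℕ, ∀ a b, φ a < φ b ↔ g a < g b := by
  let _ : LinearOrder X := LinearOrder.lift' g hg
  obtain ⟨φ⟩ := exists_orderIso_nat (X := X) h
  exact ⟨φ.toEquiv, fun a b => φ.lt_iff_lt⟩

theorem rank_eq_top_of_path {X L : Type*} [LinearOrder L] [WellFoundedLT L] [OrderTop L]
    (ρ : X → L) (st : X → ℕ) (T : Set X) (R : ℕ → Set L) (hfin : ∀ n, {x | st x = n}.Finite)
    (hR : ∀ x ∈ T, ∀ n ≥ st x, ρ x ∈ R n) (htop : ∀ n, ⊤ ∈ R n)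
    (w : ℕ → X) (hw : Function.Injective w)
    (hstep : ∀ i, ρ (w i) ≠ ⊤ → st (w i) ≤ st (w (i + 1)) ∧
      (ρ (w (i + 1)) < ρ (w i) ∨
        (ρ (w (i + 1)) = ρ (w i) ∧ st (w (i + 1)) = st (w i) ∧ (w i ∈ T → w (i + 1) ∈ T)) ∨
        (w i ∉ T ∧ w (i + 1) ∈ T ∧ ∀ α ∈ R (st (w i)),
          (ρ (w i) < α → ρ (w (i + 1)) < α) ∧ (ρ (w i) ≤ α → ρ (w (i + 1)) ≤ α)))) :
    ρ (w 0) = ⊤ := by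
  by_contra h0
  have hne : ∀ i, ρ (w i) ≠ ⊤ := by
    intro i
    induction i with
    | zero => exact h0
    | succ i ih =>
      rcases (hstep i ih).2 with h | h | h
      · exact h.ne_top
      · rwa [h.1]
      · exact ((h.2.2 ⊤ (htop _)).1 (lt_top_iff_ne_top.2 ih)).ne
  replace hstep := fun i => hstep i (hne i)
  have hst : Monotone (st ∘ w) := monotone_nat_of_le_succ fun i => (hstep i).1
  let K : ℕ → Prop := fun i => w i ∉ T ∧ w (i + 1) ∈ T ∧ ∀ α ∈ R (st (w i)),
    (ρ (w i) < α → ρ (w (i + 1)) < α) ∧ (ρ (w i) ≤ α → ρ (w (i + 1)) ≤ α)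
  have hdesc : ∀ i, ¬ K i → ρ (w (i + 1)) ≤ ρ (w i) := by
    intro i hi
    rcases (hstep i).2 with h | h | h
    · exact h.le
    · exact h.1.le
    · exact absurd h hi
  have hflat : ∀ i, ¬ K i → ρ (w (i + 1)) = ρ (w i) →
      st (w (i + 1)) = st (w i) ∧ (w i ∈ T → w (i + 1) ∈ T) := by
    intro i hi hρ
    rcases (hstep i).2 with h | h | h
    · exact absurd hρ h.ne
    · exact h.2
    · exact absurd h hi
  have hbound : ∀ i, w i ∈ T → ∀ k ≥ i, ρ (w k) ≤ ρ (w i) := by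
    intro i hi k hk
    induction k, hk using Nat.le_induction with
    | base => exact le_rfl
    | succ k hk ih =>
      by_cases hKk : K k
      · exact (hKk.2.2 _ (hR _ hi _ (hst hk))).2 ih
      · exact (hdesc k hKk).trans ih
  by_cases hK : ∃ n, ∀ i ≥ n, ¬ K i
  · obtain ⟨n, hn⟩ := hK
    have hanti : Antitone fun i => ρ (w (n + i)) :=
      antitone_nat_of_succ_le fun i => hdesc _ (hn _ (Nat.le_add_right _ _))
    obtain ⟨m, hm⟩ := WellFoundedLT.antitone_chain_condition hanti
    have hconst : ∀ k, st (w (n + m + k)) = st (w (n + m)) := by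
      intro k
      induction k with
      | zero => rfl
      | succ k ih =>
        refine ((hflat (n + m + k) (hn _ (by omega)) ?_).1).trans ih
        have h₁ := hm (m + k) (by omega)
        have h₂ := hm (m + k + 1) (by omega)
        simpa only [add_assoc] using h₂.symm.trans h₁
    exact Set.infinite_of_injective_forall_mem
      (hw.comp (add_right_injective (n + m))) hconst (hfin _)
  · push Not at hK
    obtain ⟨i, hi, hmin⟩ : ∃ i, K i ∧ ∀ j, K j → ρ (w (i + 1)) ≤ ρ (w (j + 1)) := by
      obtain ⟨i₀, -, hi₀⟩ := hK 0
      obtain ⟨i, hi, hmin⟩ := (InvImage.wf (fun i => ρ (w (i + 1))) wellFounded_lt).has_min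
        {i | K i} ⟨i₀, hi₀⟩
      exact ⟨i, hi, fun j hj => not_lt.1 (hmin j hj)⟩
    classical
    obtain ⟨hj₁, hKj⟩ := Nat.find_spec (hK (i + 1))
    have hlt : ∀ k, i + 1 ≤ k → k < Nat.find (hK (i + 1)) → ¬ K k :=
      fun k hk hkj h => Nat.find_min (hK (i + 1)) hkj ⟨hk, h⟩
    generalize Nat.find (hK (i + 1)) = j at hj₁ hKj hlt
    have hρj : ρ (w (i + 1)) ≤ ρ (w j) := by
      by_contra! h
      exact ((hKj.2.2 _ (hR _ hi.2.1 _ (hst hj₁))).1 h).not_ge (hmin j hKj)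
    have hanti : ∀ k, i + 1 ≤ k → k ≤ j → ρ (w j) ≤ ρ (w k) := by
      intro k hk hkj
      induction hkj using Nat.decreasingInduction with
      | self => exact le_rfl
      | of_succ k hkj ih => exact (ih (by omega)).trans (hdesc k (hlt k hk hkj))
    have hρ : ∀ k, i + 1 ≤ k → k ≤ j → ρ (w k) = ρ (w (i + 1)) := fun k hk hkj =>
      le_antisymm (hbound _ hi.2.1 k hk) (hρj.trans (hanti k hk hkj))
    have hT : ∀ k, i + 1 ≤ k → k ≤ j → w k ∈ T := by
      intro k hk
      induction k, hk using Nat.le_induction with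
      | base => exact fun _ => hi.2.1
      | succ k hk ih =>
        intro hkj
        exact (hflat k (hlt k hk hkj) ((hρ _ (by omega) hkj).trans (hρ k hk (by omega)).symm)).2
          (ih (by omega))
    exact hKj.1 (hT j hj₁ le_rfl)

theorem exists_equiv_nat_rank_eq_top {X L : Type*} [Countable X] [Infinite X] [LinearOrder L]
    [WellFoundedLT L] [OrderTop L] (N : X → X → Prop) (ρ : X → L)
    (hρ : ∀ v, ρ v ≠ ⊤ → {u | N v u ∧ ρ v ≤ ρ u}.Finite) :
    ∃ φ : X ≃ ℕ, ∀ w : ℕ → X,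
      (∀ i, N (w i) (w (i + 1)) ∧ φ (w i) < φ (w (i + 1))) → ρ (w 0) = ⊤ := by
  classical
  have hF : ∀ v, ∃ f : Finset X, ρ v ≠ ⊤ → ∀ u, N v u → ρ v ≤ ρ u → u ∈ f := by
    intro v
    by_cases hv : ρ v = ⊤
    · exact ⟨∅, fun h => absurd hv h⟩
    · exact ⟨(hρ v hv).toFinset, fun _ u hu hvu => by simpa using ⟨hu, hvu⟩⟩
  choose F hF using hF
  obtain ⟨v, hv⟩ := exists_surjective_nat X
  obtain ⟨e, he⟩ := exists_injective_nat X
  choose cl hcl hcross using fun P : Finset X =>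
    exists_finset_not_crossing F ρ (insert ⊤ (P.image ρ)) (P ∪ P.biUnion F)
  let s : ℕ → Finset X :=
    Nat.rec ∅ fun i t => cl (insert (v i) (t ∪ t.biUnion F))
  let P : ℕ → Finset X := fun i => insert (v i) (s i ∪ (s i).biUnion F)
  have hs : ∀ i, s (i + 1) = cl (P i) := fun _ => rfl
  have hPs : ∀ i, P i ⊆ s (i + 1) := fun i => Finset.union_subset_left (hcl (P i))
  have hFPs : ∀ i, ∀ a ∈ P i, F a ⊆ s (i + 1) := fun i a ha =>
    (Finset.subset_biUnion_of_mem F ha).trans (Finset.union_subset_right (hcl (P i)))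
  have hsP : ∀ i, s i ⊆ P i := fun i =>
    Finset.subset_union_left.trans (Finset.subset_insert _ _)
  have hFsP : ∀ i, ∀ a ∈ s i, F a ⊆ P i := fun i a ha =>
    (Finset.subset_biUnion_of_mem F ha).trans
      (Finset.subset_union_right.trans (Finset.subset_insert _ _))
  have hmono : Monotone P := monotone_nat_of_le_succ fun i => (hPs i).trans (hsP (i + 1))
  have hex : ∀ x, ∃ i, x ∈ s (i + 1) := by
    intro x
    obtain ⟨i, rfl⟩ := hv x
    exact ⟨i, hPs i (Finset.mem_insert_self _ _)⟩
  let st : X → ℕ := fun x => Nat.find (hex x)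
  have hst : ∀ x, x ∈ s (st x + 1) := fun x => Nat.find_spec (hex x)
  have hst_le : ∀ x i, x ∈ s (i + 1) → st x ≤ i := fun x i h => Nat.find_min' (hex x) h
  let T : Set X := {x | x ∈ P (st x)}
  let g : X → ℕ ×ₗ Lᵒᵈ ×ₗ ℕ ×ₗ ℕ := fun x =>
    toLex (st x, toLex (OrderDual.toDual (ρ x), toLex (if x ∈ T then 1 else 0, e x)))
  have hg : Function.Injective g := fun a b hab => by
    simp only [g, EmbeddingLike.apply_eq_iff_eq, Prod.mk.injEq] at hab
    exact he hab.2.2.2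
  have hfin : ∀ n, {x | st x ≤ n}.Finite := by
    intro n
    refine (P (n + 1)).finite_toSet.subset fun x hx => ?_
    exact hmono (Nat.succ_le_succ hx) (hsP _ (hst x))
  obtain ⟨φ, hφ⟩ := exists_equiv_nat_lt_iff_s16 g hg fun x => (hfin (st x)).subset fun y hy => by
    have := Prod.Lex.toLex_le_toLex.1 hy
    rcases this with h | h
    · exact le_of_lt h
    · exact le_of_eq h.1
  refine ⟨φ, fun w hw => rank_eq_top_of_path ρ st T
    (fun n => (insert ⊤ ((P n).image ρ) : Finset L)) (fun n => (hfin n).subset fun x hx => le_of_eq hx)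
    (fun x hx n hn => ?_) (fun n => by simp) w ?_ fun i hi => ?_⟩
  · exact Finset.mem_coe.2 (Finset.mem_insert_of_mem (Finset.mem_image_of_mem ρ (hmono hn hx)))
  · exact Function.Injective.of_comp (f := φ) (strictMono_nat_of_lt_succ fun i => (hw i).2).injective
  · obtain ⟨hN, hlt⟩ := hw i
    generalize w i = a at *
    generalize w (i + 1) = b at *
    rw [hφ] at hlt
    simp only [g, Prod.Lex.toLex_lt_toLex, OrderDual.toDual_lt_toDual,
      OrderDual.toDual_inj] at hlt
    by_cases hab : ρ b < ρ a
    · exact ⟨by omega, .inl hab⟩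
    have hbF : b ∈ F a := hF a hi b hN (not_lt.1 hab)
    rcases hlt with hlt | ⟨hsteq, hlt | ⟨hρeq, hlt⟩⟩
    · have hbs : b ∉ s (st a + 1) := fun h => by
        have := hst_le b _ h
        omega
      have hbP : b ∈ P (st a + 1) := hFsP _ a (hst a) hbF
      have hstb : st b = st a + 1 := le_antisymm (hst_le b _ (hPs _ hbP)) hlt
      refine ⟨hlt.le, .inr (.inr ⟨fun ha => hbs (hFPs _ a ha hbF), ?_, fun α hα => ?_⟩)⟩
      · change b ∈ P (st b)
        rwa [hstb]
      · exact hcross (P (st a)) a (hst a) b hbF hbs α (Finset.mem_coe.1 hα)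
    · exact absurd hlt hab
    · refine ⟨hsteq.le, .inr (.inl ⟨hρeq.symm, hsteq.symm, fun ha => ?_⟩)⟩
      by_contra hb
      simp [ha, hb] at hlt

theorem exists_core_and_equiv_nat {X : Type*} [Countable X] [Infinite X] (N : X → X → Prop) :
    ∃ W : Set X, (∀ v ∈ W, {u | u ∈ W ∧ N v u}.Infinite) ∧ ∃ φ : X ≃ ℕ, ∀ w : ℕ → X,
      (∀ i, N (w i) (w (i + 1)) ∧ φ (w i) < φ (w (i + 1))) → w 0 ∈ W := by
  obtain ⟨ρ, hρ, htop⟩ := exists_rank N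
  obtain ⟨φ, hφ⟩ := exists_equiv_nat_rank_eq_top N ρ hρ
  exact ⟨{v | ρ v = ⊤}, fun v hv => (htop v hv).mono fun u hu => ⟨hu.2, hu.1⟩, φ, hφ⟩

theorem exists_forward_path {X : Type*} (N : X → X → Prop) (f : X → ℤ)
    (hf : Function.Injective f) (W : Set X) (hW : ∀ v ∈ W, {u | u ∈ W ∧ N v u}.Infinite)
    (hpos : ∀ v ∈ W, 0 ≤ f v) (x : X) (hx : x ∈ W) :
    ∃ w : ℕ → X, w 0 = x ∧ ∀ i, w i ∈ W ∧ N (w i) (w (i + 1)) ∧ f (w i) < f (w (i + 1)) := by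
  have hnext : ∀ v : W, ∃ u : W, N v u ∧ f v < f u := by
    rintro ⟨v, hv⟩
    by_contra! h
    refine hW v hv (((Set.finite_Icc 0 (f v)).preimage hf.injOn).subset ?_)
    exact fun u hu => ⟨hpos u hu.1, h ⟨u, hu.1⟩ hu.2⟩
  choose next hnext using hnext
  exact ⟨fun i => (next^[i] ⟨x, hx⟩ : W), rfl, fun i => ⟨Subtype.coe_prop _, by
    simpa only [Function.iterate_succ_apply'] using hnext _⟩⟩

theorem exists_neg_and_nonneg_succ (f : ℤ → ℤ) (hf : StrictMono f) :
    ∃ i, f i < 0 ∧ 0 ≤ f (i + 1) := by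
  have hup : ∀ n : ℕ, f 0 + n ≤ f n := by
    intro n
    induction n with
    | zero => simp
    | succ n ih =>
      have := hf (show (n : ℤ) < (n + 1 : ℕ) by omega)
      omega
  have hdown : ∀ n : ℕ, f (-n) ≤ f 0 - n := by
    intro n
    induction n with
    | zero => simp
    | succ n ih =>
      have := hf (show -((n + 1 : ℕ) : ℤ) < -n by omega)
      omega
  obtain ⟨i, hi, hmax⟩ := Int.exists_greatest_of_bdd (P := fun i => f i < 0)
    ⟨((f 0).natAbs : ℤ), fun z hz => by
      by_contra! hlt
      have := hf hlt
      have := hup (f 0).natAbs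
      omega⟩
    ⟨-((f 0).natAbs + 1 : ℕ), by
      have := hdown ((f 0).natAbs + 1)
      omega⟩
  refine ⟨i, hi, not_lt.1 fun h => ?_⟩
  have := hmax _ h
  omega


theorem stmt16 {V : Type*} [Countable V] [Infinite V] (E : Set (V × V)) :
    (∀ V₁ : Set V, V₁.Infinite → V₁ᶜ.Infinite →
      ∃ W₁ ⊆ V₁, ∃ W₂ ⊆ V₁ᶜ,
        (∀ v ∈ W₁, {u | u ∈ W₁ ∧ (v, u) ∈ E}.Infinite) ∧
        (∀ v ∈ W₂, {u | u ∈ W₂ ∧ (u, v) ∈ E}.Infinite) ∧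
        ∃ w₁ ∈ W₁, ∃ w₂ ∈ W₂, (w₂, w₁) ∈ E) ↔
    (∀ φ : V ≃ ℤ, ∃ w : ℤ → V, Function.Injective w ∧
      ∀ i : ℤ, (w i, w (i + 1)) ∈ E ∧ φ (w i) < φ (w (i + 1))) := by
  classical
  constructor
  · intro h φ
    have hinf : ∀ S : Set ℤ, S.Infinite → (φ ⁻¹' S).Infinite := fun S hS =>
      hS.preimage (by simp)
    obtain ⟨W₁, hW₁, W₂, hW₂, hout, hin, w₁, hw₁, w₂, hw₂, hE⟩ :=
      h (φ ⁻¹' Set.Ici 0) (hinf _ (Set.Ici_infinite 0))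
        (by rw [← Set.preimage_compl, Set.compl_Ici]; exact hinf _ (Set.Iio_infinite 0))
    have hneg : ∀ v ∈ W₂, φ v < 0 := fun v hv => by simpa using hW₂ hv
    obtain ⟨p, hp₀, hp⟩ := exists_forward_path (fun v u => (v, u) ∈ E) φ φ.injective W₁ hout
      (fun v hv => hW₁ hv) w₁ hw₁
    obtain ⟨q, hq₀, hq⟩ := exists_forward_path (fun v u => (u, v) ∈ E) (fun v => -φ v)
      (neg_injective.comp φ.injective) W₂ hin
      (fun v hv => neg_nonneg.2 (hneg v hv).le) w₂ hw₂
    let w : ℤ → V := fun i => Int.casesOn i p q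
    have hstep : ∀ i : ℤ, (w i, w (i + 1)) ∈ E ∧ φ (w i) < φ (w (i + 1)) := by
      rintro (n | _ | n)
      · exact (hp n).2
      · change (q 0, p 0) ∈ E ∧ φ (q 0) < φ (p 0)
        rw [hp₀, hq₀]
        exact ⟨hE, (hneg w₂ hw₂).trans_le (hW₁ hw₁)⟩
      · exact ⟨(hq n).2.1, neg_lt_neg_iff.1 (hq n).2.2⟩
    exact ⟨w, Function.Injective.of_comp (f := φ)
      (strictMono_int_of_lt_succ fun i => (hstep i).2).injective, hstep⟩
  · intro h V₁ hV₁ hV₂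
    have : Infinite V₁ := hV₁.to_subtype
    have : Infinite ↥(V₁ᶜ) := hV₂.to_subtype
    obtain ⟨W₁, hW₁, φ₁, hφ₁⟩ := exists_core_and_equiv_nat fun v u : V₁ => ((v : V), (u : V)) ∈ E
    obtain ⟨W₂, hW₂, φ₂, hφ₂⟩ :=
      exists_core_and_equiv_nat fun v u : ↥(V₁ᶜ) => ((u : V), (v : V)) ∈ E
    let φ : V ≃ ℤ := ((Equiv.Set.sumCompl V₁).symm.trans (Equiv.sumCongr φ₁ φ₂)).trans
      Equiv.intEquivNatSumNat.symm
    have hφV₁ : ∀ v : V₁, φ v = φ₁ v := fun v => by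
      simp [φ, Equiv.Set.sumCompl_symm_apply, Equiv.intEquivNatSumNat]
    have hφV₂ : ∀ v : ↥(V₁ᶜ), φ v = Int.negSucc (φ₂ v) := fun v => by
      simp [φ, Equiv.Set.sumCompl_symm_apply_compl, Equiv.intEquivNatSumNat]
    have hmem : ∀ v, 0 ≤ φ v → v ∈ V₁ := fun v hv => by
      by_contra hn
      rw [hφV₂ ⟨v, hn⟩] at hv
      omega
    have hnotMem : ∀ v, φ v < 0 → v ∈ V₁ᶜ := fun v hv hn => by
      rw [hφV₁ ⟨v, hn⟩] at hv
      omega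
    obtain ⟨w, -, hw⟩ := h φ
    have hmono : StrictMono fun i => φ (w i) := strictMono_int_of_lt_succ fun i => (hw i).2
    obtain ⟨i, hi₂, hi₁⟩ := exists_neg_and_nonneg_succ _ hmono
    have hp : ∀ n : ℕ, w (i + 1 + n) ∈ V₁ := fun n =>
      hmem _ (hi₁.trans (hmono.monotone (by omega)))
    have hq : ∀ n : ℕ, w (i - n) ∈ V₁ᶜ := fun n =>
      hnotMem _ ((hmono.monotone (by omega)).trans_lt hi₂)
    have hmem₁ := hφ₁ (fun n => ⟨_, hp n⟩) fun n => by
      have := hw (i + 1 + n)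
      rw [add_assoc (i + 1), ← Nat.cast_succ, hφV₁ ⟨_, hp n⟩, hφV₁ ⟨_, hp (n + 1)⟩] at this
      exact ⟨this.1, by exact_mod_cast this.2⟩
    have hmem₂ := hφ₂ (fun n => ⟨_, hq n⟩) fun n => by
      have := hw (i - (n + 1 : ℕ))
      rw [show i - (n + 1 : ℕ) + 1 = i - n by push_cast; ring,
        hφV₂ ⟨_, hq n⟩, hφV₂ ⟨_, hq (n + 1)⟩] at this
      exact ⟨this.1, by have := this.2; omega⟩
    refine ⟨Subtype.val '' W₁, Subtype.coe_image_subset _ _, Subtype.val '' W₂,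
      Subtype.coe_image_subset _ _, ?_, ?_, _, ⟨_, hmem₁, rfl⟩, _, ⟨_, hmem₂, rfl⟩, ?_⟩
    · rintro _ ⟨v, hv, rfl⟩
      refine ((hW₁ v hv).image Subtype.val_injective.injOn).mono ?_
      rintro _ ⟨u, hu, rfl⟩
      exact ⟨⟨u, hu.1, rfl⟩, hu.2⟩
    · rintro _ ⟨v, hv, rfl⟩
      refine ((hW₂ v hv).image Subtype.val_injective.injOn).mono ?_
      rintro _ ⟨u, hu, rfl⟩
      exact ⟨⟨u, hu.1, rfl⟩, hu.2⟩
    · simpa using (hw i).1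
end
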